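/- Under the stated hypotheses, the Orbit 3 (L,K,K) three-term relation holds: S(c)·A(1−a, e−a, f−a, g−a)·A(b, 1+b−e, 1+b−f, 1+b−g)·K(a;b,c,d;e,f,g) − S(b−a)·A(a,b,c,d)·A(1−c, e−c, f−c, g−c)·L(1−a, e−a, f−a, g−a; 1+d−a; 1+c−a, 1+b−a) − B_1(a,b,c,d,e,f,g)·K(b;a,c,d;e,f,g) = 0. -/

import Mathlib

noncomputable section

open Complex

/-- `Sn x = sin (π x)`. -/
def Sn (x : ℂ) : ℂ := Complex.sin ((Real.pi : ℂ) * x)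

/-- The renormalized Saalschützian series
`F*(a,b,c,d;e,f,g) = ∑ₖ Γ(k+a)Γ(k+b)Γ(k+c)Γ(k+d)/(k!·Γ(k+e)Γ(k+f)Γ(k+g))`. -/
def Fstar (a b c d e f g : ℂ) : ℂ :=
  ∑' k : ℕ, (Complex.Gamma (k + a) * Complex.Gamma (k + b) *
      Complex.Gamma (k + c) * Complex.Gamma (k + d)) /
    ((k.factorial : ℂ) * Complex.Gamma (k + e) * Complex.Gamma (k + f) *
      Complex.Gamma (k + g))

/-- The function `K(a;b,c,d;e,f,g)`. -/
def Kf (a b c d e f g : ℂ) : ℂ :=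
  (Fstar a b c d e f g +
      Fstar a (1 + a - e) (1 + a - f) (1 + a - g) (1 + a - b) (1 + a - c) (1 + a - d)) /
    (Sn a * Complex.Gamma a ^ 2 * Complex.Gamma b * Complex.Gamma c * Complex.Gamma d *
      Complex.Gamma (1 + a - e) * Complex.Gamma (1 + a - f) * Complex.Gamma (1 + a - g))

/-- The function `L(a,b,c,d;e;f,g)`. -/
def Lf (a b c d e f g : ℂ) : ℂ :=
  (Fstar a b c d e f g -
      Fstar (1 + a - e) (1 + b - e) (1 + c - e) (1 + d - e) (2 - e) (1 + f - e) (1 + g - e)) /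
    (Sn e * Complex.Gamma a * Complex.Gamma b * Complex.Gamma c * Complex.Gamma d *
      Complex.Gamma (1 + a - e) * Complex.Gamma (1 + b - e) * Complex.Gamma (1 + c - e) *
      Complex.Gamma (1 + d - e))

/-- `A(x,y,z,t) = 1/(Γ(x)Γ(y)Γ(z)Γ(t))`. -/
def Af (x y z t : ℂ) : ℂ :=
  1 / (Complex.Gamma x * Complex.Gamma y * Complex.Gamma z * Complex.Gamma t)

def B1 (a b c d e f g : ℂ) : ℂ :=
  Sn b * Sn c * (Sn (b - a) * Sn (c - a) * Sn d + Sn (e - a) * Sn (f - a) * Sn (g - a)) /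
    (Real.pi : ℂ) ^ 4

def B2 (a b c d e f g : ℂ) : ℂ :=
  Sn (f - a) * Sn (g - a) *
    (Sn (b - a) * Sn (c - a) * Sn (d - a) + Sn (e - 2 * a) * Sn (f - a) * Sn (g - a)) /
    (Real.pi : ℂ) ^ 4

def B3 (a b c d e f g : ℂ) : ℂ :=
  (Sn f * Sn (f - e) * Sn (g - a) * Sn (g - b) * Sn (g - c) * Sn (g - d) -
      Sn g * Sn (g - e) * Sn (f - a) * Sn (f - b) * Sn (f - c) * Sn (f - d)) /
    ((Real.pi : ℂ) ^ 4 * Sn (f - g))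

def B4 (a b c d e f g : ℂ) : ℂ :=
  Sn (f - a) * Sn (g - a) * (Sn b * Sn c * Sn d + Sn (e - a) * Sn f * Sn g) /
    (Real.pi : ℂ) ^ 4

def B5 (a b c d e f g : ℂ) : ℂ :=
  Sn b * Sn (e - b) *
    (Sn (b - a) * Sn (c - a) * Sn (d - a) + Sn (e - 2 * a) * Sn (f - a) * Sn (g - a)) /
    (Real.pi : ℂ) ^ 4

def Cf (a b c d e f g : ℂ) : ℂ :=
  Sn (e - a) * (Sn b * Sn c * Sn d * B2 a b c d e f g +
      Sn e * Sn (f - a) * Sn (g - a) * B4 a b c d e f g) / (Real.pi : ℂ) ^ 4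

/-- `x` is not an integer. -/
def NonInt (x : ℂ) : Prop := ∀ m : ℤ, x ≠ m

/-- The rising factorial `x (x + 1) ⋯ (x + n - 1)`. -/
def poch (x : ℂ) (n : ℕ) : ℂ := ∏ j ∈ Finset.range n, (x + j)

@[simp] lemma poch_zero (x : ℂ) : poch x 0 = 1 := by simp [poch]

lemma poch_succ (x : ℂ) (n : ℕ) : poch x (n + 1) = poch x n * (x + n) := by
  simp [poch, Finset.prod_range_succ]

lemma poch_add (x : ℂ) (m n : ℕ) : poch x (m + n) = poch x m * poch (x + m) n := by
  simp [poch, Finset.prod_range_add, add_assoc]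

lemma poch_succ' (x : ℂ) (n : ℕ) : poch x (n + 1) = x * poch (x + 1) n := by
  rw [add_comm, poch_add]
  simp [poch]

lemma NonInt.add_int {x : ℂ} (h : NonInt x) (m : ℤ) : NonInt (x + m) := by
  intro k hk
  exact h (k - m) (by push_cast; linear_combination hk)

lemma NonInt.of_eq_add {x y : ℂ} (h : NonInt x) (m : ℤ) (hy : y = x + m) : NonInt y :=
  hy ▸ h.add_int m

lemma NonInt.neg {x : ℂ} (h : NonInt x) : NonInt (-x) := by
  intro k hk
  exact h (-k) (by push_cast; linear_combination -hk)

lemma NonInt.of_eq_sub {x y : ℂ} (h : NonInt x) (m : ℤ) (hy : y = m - x) : NonInt y :=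
  h.neg.of_eq_add m (by rw [hy]; ring)

lemma NonInt.ne_zero {x : ℂ} (h : NonInt x) : x ≠ 0 := by simpa using h 0

lemma NonInt.poch_ne_zero {x : ℂ} (h : NonInt x) (n : ℕ) : poch x n ≠ 0 := by
  rw [poch, Finset.prod_ne_zero_iff]
  intro j _
  have := (h.add_int j).ne_zero
  simpa using this

lemma poch_neg_eq_zero {n k : ℕ} (h : n < k) : poch (-n) k = 0 := by
  rw [poch, Finset.prod_eq_zero_iff]
  exact ⟨n, by simpa using h, by simp⟩

/-- The terms of a terminating very-well-poised series `₇F₆(1)`. -/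
def dougallTerm (l B C D E : ℂ) (n k : ℕ) : ℂ :=
  (l + 2 * k) / l * (poch l k * poch B k * poch C k * poch D k * poch E k * poch (-n) k) /
    (k.factorial * poch (1 + l - B) k * poch (1 + l - C) k * poch (1 + l - D) k *
      poch (1 + l - E) k * poch (1 + l + n) k)

lemma dougall_step (l B C D E k n : ℂ) (hE : E = 1 + 2 * l + n - B - C - D)
    (h1 : k + 1 ≠ 0) (hB : 1 + l - B + k ≠ 0) (hC : 1 + l - C + k ≠ 0) (hD : 1 + l - D + k ≠ 0)
    (hE1 : 1 + l - E + k ≠ 0) (hE0 : l - E ≠ 0) (hn : 2 + l + n + k ≠ 0) (hn' : 1 + l + n ≠ 0)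
    (hB' : 1 + l + n - B ≠ 0) (hC' : 1 + l + n - C ≠ 0) (hD' : 1 + l + n - D ≠ 0) :
    (l + 2 * (k + 1)) * ((E + 1 + k) * (-n - 1)) / ((k + 1) * (1 + l - B + k) * (1 + l - C + k) *
      (1 + l - D + k) * (l - E) * (2 + l + n + k)) -
    (1 + l + n) * (1 + l + n - B - C) * (1 + l + n - B - D) * (1 + l + n - C - D) /
      ((1 + l + n - B) * (1 + l + n - C) * (1 + l + n - D) * (E - l)) *
    ((l + 2 * (k + 1)) * (E * (k - n)) / ((k + 1) * (1 + l - B + k) * (1 + l - C + k) *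
      (1 + l - D + k) * (1 + l - E + k) * (1 + l + n))) =
    (-(E + n + 1) / ((1 + l + n - B) * (1 + l + n - C) * (1 + l + n - D) * (E - l))) *
    ((l + 1 + k) * (B + k + 1) * (C + k + 1) * (D + k + 1) * (E + 1 + k) * (k - n) /
      ((k + 1) * (1 + l - B + k) * (1 + l - C + k) * (1 + l - D + k) * (1 + l - E + k) *
        (2 + l + n + k)) - 1) := by
  have hE0' : E - l ≠ 0 := fun h => hE0 (by linear_combination -h)
  have : l - E = -(E - l) := by ring
  rw [this]
  have e1 : (1 + l - E + k) = k + 1 - (E - l) := by ring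
  field_simp
  subst hE
  ring

lemma factorial_ne (n : ℕ) : (n.factorial : ℂ) ≠ 0 := by exact_mod_cast n.factorial_ne_zero

/-- The quotient of two consecutive values of Dougall's sum. -/
def dougallRatio (l B C D : ℂ) (n : ℂ) : ℂ :=
  (1 + l + n) * (1 + l + n - B - C) * (1 + l + n - B - D) * (1 + l + n - C - D) /
    ((1 + l + n - B) * (1 + l + n - C) * (1 + l + n - D) * (1 + l + n - B - C - D))

/-- The telescoping certificate for Dougall's sum. -/
def dougallCert (l B C D E : ℂ) (n K : ℕ) : ℂ :=
  poch (l + 1) K * poch B (K + 1) * poch C (K + 1) * poch D (K + 1) * poch (E + 1) K *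
    poch (-n) K / (K.factorial * poch (1 + l - B) K * poch (1 + l - C) K * poch (1 + l - D) K *
      poch (1 + l - E) K * poch (2 + l + n) K)

set_option maxHeartbeats 2000000 in
lemma dougall_partial (l B C D E : ℂ) (n : ℕ) (hE : E = 1 + 2 * l + n - B - C - D)
    (hl : NonInt l) (hB : NonInt (l - B)) (hC : NonInt (l - C)) (hD : NonInt (l - D))
    (hlE : NonInt (l - E)) (K : ℕ) :
    ∑ k ∈ Finset.range (K + 1), (dougallTerm l B C D (E + 1) (n + 1) k -
      dougallRatio l B C D n * dougallTerm l B C D E n k) =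
    -(E + n + 1) / ((1 + l + n - B) * (1 + l + n - C) * (1 + l + n - D) * (E - l)) *
      dougallCert l B C D E n K := by
  have hEl : 1 + l + n - B - C - D = E - l := by rw [hE]; ring
  have hEl0 : E - l ≠ 0 := (hlE.of_eq_sub 0 (by push_cast; ring) : NonInt (E - l)).ne_zero
  have hB' : 1 + l + n - B ≠ 0 := (hB.of_eq_add (1 + n) (by push_cast; ring)).ne_zero
  have hC' : 1 + l + n - C ≠ 0 := (hC.of_eq_add (1 + n) (by push_cast; ring)).ne_zero
  have hD' : 1 + l + n - D ≠ 0 := (hD.of_eq_add (1 + n) (by push_cast; ring)).ne_zero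
  induction K with
  | zero =>
    simp only [dougallTerm, dougallRatio, dougallCert, hEl, zero_add, Finset.sum_range_one,
      poch_zero, poch_succ, Nat.factorial_zero]
    have := hl.ne_zero
    push_cast
    field_simp
    subst hE
    ring
  | succ K ih =>
    rw [Finset.sum_range_succ, ih]
    have hK : (K : ℂ) + 1 ≠ 0 := by exact_mod_cast K.succ_ne_zero
    have hBK : 1 + l - B + K ≠ 0 := (hB.of_eq_add (1 + K) (by push_cast; ring)).ne_zero
    have hCK : 1 + l - C + K ≠ 0 := (hC.of_eq_add (1 + K) (by push_cast; ring)).ne_zero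
    have hDK : 1 + l - D + K ≠ 0 := (hD.of_eq_add (1 + K) (by push_cast; ring)).ne_zero
    have hEK : 1 + l - E + K ≠ 0 := (hlE.of_eq_add (1 + K) (by push_cast; ring)).ne_zero
    have hn : 2 + l + n + K ≠ 0 := (hl.of_eq_add (2 + n + K) (by push_cast; ring)).ne_zero
    have hn' : 1 + l + n ≠ 0 := (hl.of_eq_add (1 + n) (by push_cast; ring)).ne_zero
    have key := dougall_step l B C D E K n hE hK hBK hCK hDK hEK hlE.ne_zero hn hn' hB' hC' hD'
    have pB : poch (1 + l - B) K ≠ 0 := (hB.of_eq_add 1 (by push_cast; ring)).poch_ne_zero K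
    have pC : poch (1 + l - C) K ≠ 0 := (hC.of_eq_add 1 (by push_cast; ring)).poch_ne_zero K
    have pD : poch (1 + l - D) K ≠ 0 := (hD.of_eq_add 1 (by push_cast; ring)).poch_ne_zero K
    have pE : poch (1 + l - E) K ≠ 0 := (hlE.of_eq_add 1 (by push_cast; ring)).poch_ne_zero K
    have pn : poch (2 + l + n) K ≠ 0 :=
      (hl.of_eq_add (2 + n) (by push_cast; ring)).poch_ne_zero K
    have hf := factorial_ne K
    have hl0 := hl.ne_zero
    have t1 : dougallTerm l B C D (E + 1) (n + 1) (K + 1) = dougallCert l B C D E n K *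
        ((l + 2 * (K + 1)) * ((E + 1 + K) * (-n - 1)) / ((K + 1) * (1 + l - B + K) *
          (1 + l - C + K) * (1 + l - D + K) * (l - E) * (2 + l + n + K))) := by
      have e1 : poch (-((n + 1 : ℕ) : ℂ)) (K + 1) = (-n - 1) * poch (-n) K := by
        rw [poch_succ']; push_cast
        rw [show -((n : ℂ) + 1) + 1 = -n by ring]; ring
      have e2 : poch (1 + l - (E + 1)) (K + 1) = (l - E) * poch (1 + l - E) K := by
        rw [poch_succ', show 1 + l - (E + 1) = l - E by ring, show l - E + 1 = 1 + l - E by ring]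
      have e3 : 1 + l + ((n + 1 : ℕ) : ℂ) = 2 + l + n := by push_cast; ring
      have hlE0 := hlE.ne_zero
      rw [dougallTerm, dougallCert, e1, e2, e3, poch_succ' l K, poch_succ (E + 1) K,
        poch_succ (2 + l + n) K, poch_succ (1 + l - B) K, poch_succ (1 + l - C) K,
        poch_succ (1 + l - D) K, Nat.factorial_succ]
      push_cast
      clear key
      generalize poch (1 + l - B) K = qB at *
      generalize poch (1 + l - C) K = qC at *
      generalize poch (1 + l - D) K = qD at *
      generalize poch (1 + l - E) K = qE at *
      generalize poch (2 + l + n) K = qn at *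
      generalize poch (l + 1) K = rl at *
      generalize poch (E + 1) K = rE at *
      generalize poch (-n) K = rn at *
      generalize poch B (K + 1) = rB at *
      generalize poch C (K + 1) = rC at *
      generalize poch D (K + 1) = rD at *
      generalize 1 + l - B + (K : ℂ) = vB at *
      generalize 1 + l - C + (K : ℂ) = vC at *
      generalize 1 + l - D + (K : ℂ) = vD at *
      generalize 1 + l - E + (K : ℂ) = vE at *
      generalize 2 + l + n + (K : ℂ) = vn at *
      field_simp
    have t2 : dougallTerm l B C D E n (K + 1) = dougallCert l B C D E n K *
        ((l + 2 * (K + 1)) * (E * (K - n)) / ((K + 1) * (1 + l - B + K) *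
          (1 + l - C + K) * (1 + l - D + K) * (1 + l - E + K) * (1 + l + n))) := by
      have e3 : poch (1 + l + n) (K + 1) = (1 + l + n) * poch (2 + l + n) K := by
        rw [poch_succ', show 1 + l + (n : ℂ) + 1 = 2 + l + n by ring]
      rw [dougallTerm, dougallCert, e3, poch_succ' l K, poch_succ' E K, poch_succ (-n) K,
        poch_succ (1 + l - E) K, poch_succ (1 + l - B) K, poch_succ (1 + l - C) K,
        poch_succ (1 + l - D) K, Nat.factorial_succ]
      push_cast
      clear key
      generalize poch (1 + l - B) K = qB at *
      generalize poch (1 + l - C) K = qC at *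
      generalize poch (1 + l - D) K = qD at *
      generalize poch (1 + l - E) K = qE at *
      generalize poch (2 + l + n) K = qn at *
      generalize poch (l + 1) K = rl at *
      generalize poch (E + 1) K = rE at *
      generalize poch (-n) K = rn at *
      generalize poch B (K + 1) = rB at *
      generalize poch C (K + 1) = rC at *
      generalize poch D (K + 1) = rD at *
      generalize 1 + l - B + (K : ℂ) = vB at *
      generalize 1 + l - C + (K : ℂ) = vC at *
      generalize 1 + l - D + (K : ℂ) = vD at *
      generalize 1 + l - E + (K : ℂ) = vE at *
      generalize 2 + l + n + (K : ℂ) = vn at *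
      field_simp
      ring
    have t3 : dougallCert l B C D E n (K + 1) = dougallCert l B C D E n K *
        ((l + 1 + K) * (B + K + 1) * (C + K + 1) * (D + K + 1) * (E + 1 + K) * (K - n) /
          ((K + 1) * (1 + l - B + K) * (1 + l - C + K) * (1 + l - D + K) * (1 + l - E + K) *
            (2 + l + n + K))) := by
      rw [dougallCert, dougallCert, poch_succ (l + 1) K, poch_succ (E + 1) K, poch_succ (-n) K,
        poch_succ (2 + l + n) K, poch_succ (1 + l - E) K, poch_succ (1 + l - B) K,
        poch_succ (1 + l - C) K, poch_succ (1 + l - D) K, poch_succ B (K + 1),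
        poch_succ C (K + 1), poch_succ D (K + 1), Nat.factorial_succ]
      push_cast
      clear key
      generalize poch (1 + l - B) K = qB at *
      generalize poch (1 + l - C) K = qC at *
      generalize poch (1 + l - D) K = qD at *
      generalize poch (1 + l - E) K = qE at *
      generalize poch (2 + l + n) K = qn at *
      generalize poch (l + 1) K = rl at *
      generalize poch (E + 1) K = rE at *
      generalize poch (-n) K = rn at *
      generalize poch B (K + 1) = rB at *
      generalize poch C (K + 1) = rC at *
      generalize poch D (K + 1) = rD at *
      generalize 1 + l - B + (K : ℂ) = vB at *
      generalize 1 + l - C + (K : ℂ) = vC at *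
      generalize 1 + l - D + (K : ℂ) = vD at *
      generalize 1 + l - E + (K : ℂ) = vE at *
      generalize 2 + l + n + (K : ℂ) = vn at *
      field_simp
      ring
    rw [t1, t2, t3, dougallRatio, hEl]
    linear_combination dougallCert l B C D E n K * key

/-- Dougall's summation of the terminating 2-balanced very-well-poised `₇F₆(1)`. -/
lemma dougall (l B C D : ℂ) (hl : NonInt l) (hB : NonInt (l - B)) (hC : NonInt (l - C))
    (hD : NonInt (l - D)) (hBCD : NonInt (l - B - C - D)) (n : ℕ) :
    ∑ k ∈ Finset.range (n + 1), dougallTerm l B C D (1 + 2 * l + n - B - C - D) n k =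
      poch (1 + l) n * poch (1 + l - B - C) n * poch (1 + l - B - D) n * poch (1 + l - C - D) n /
        (poch (1 + l - B) n * poch (1 + l - C) n * poch (1 + l - D) n *
          poch (1 + l - B - C - D) n) := by
  induction n with
  | zero =>
    simp [dougallTerm, hl.ne_zero]
  | succ n ih =>
    have h := dougall_partial l B C D _ n rfl hl hB hC hD
      (hBCD.of_eq_sub (-1 - n) (by push_cast; ring)) (n + 1)
    have h0 : dougallCert l B C D (1 + 2 * l + n - B - C - D) n (n + 1) = 0 := by
      rw [dougallCert, poch_neg_eq_zero n.lt_succ_self]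
      simp
    have h1 : dougallTerm l B C D (1 + 2 * l + n - B - C - D) n (n + 1) = 0 := by
      rw [dougallTerm, poch_neg_eq_zero n.lt_succ_self]
      simp
    rw [h0, mul_zero, Finset.sum_sub_distrib, ← Finset.mul_sum, Finset.sum_range_succ _ (n + 1),
      Finset.sum_range_succ (dougallTerm l B C D (1 + 2 * l + n - B - C - D) n) (n + 1), h1, ih,
      add_zero, ← Finset.sum_range_succ, sub_eq_zero] at h
    have e : 1 + 2 * l + ((n + 1 : ℕ) : ℂ) - B - C - D = 1 + 2 * l + n - B - C - D + 1 := by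
      push_cast; ring
    rw [e, h, dougallRatio]
    simp only [poch_succ]
    rw [div_mul_div_comm]
    congr 1 <;> ring

lemma poch_reflect (x : ℂ) (k : ℕ) : poch (1 - x - k) k = (-1) ^ k * poch x k := by
  induction k generalizing x with
  | zero => simp
  | succ k ih =>
    rw [poch_succ, poch_succ', show 1 - x - ((k + 1 : ℕ) : ℂ) = 1 - (x + 1) - k by push_cast; ring,
      ih, pow_succ]
    ring

lemma poch_nat (m k : ℕ) : poch (m + 1) k * m.factorial = (m + k).factorial := by
  induction k with
  | zero => simp
  | succ k ih =>
    rw [poch_succ, ← add_assoc, Nat.factorial_succ, Nat.cast_mul, ← ih]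
    push_cast
    ring

lemma poch_neg_nat (m k : ℕ) :
    poch (-((k + m : ℕ) : ℂ)) k = (-1) ^ k * (k + m).factorial / m.factorial := by
  rw [eq_div_iff (factorial_ne m), show -((k + m : ℕ) : ℂ) = 1 - (m + 1) - k by push_cast; ring,
    poch_reflect, mul_assoc, poch_nat, add_comm]

/-- The terms of a terminating very-well-poised `₉F₈(1)`. -/
def baileyTerm (a b c d e f g : ℂ) (n k : ℕ) : ℂ :=
  (a + 2 * k) / a * (poch a k * poch b k * poch c k * poch d k * poch e k * poch f k * poch g k *
    poch (-n) k) / (k.factorial * poch (1 + a - b) k * poch (1 + a - c) k * poch (1 + a - d) k *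
      poch (1 + a - e) k * poch (1 + a - f) k * poch (1 + a - g) k * poch (1 + a + n) k)

set_option maxHeartbeats 1000000 in
lemma bailey_inner_term (a e f g l : ℂ) (ha : NonInt a) (hl : NonInt l) (hal : NonInt (a - l))
    (he : NonInt (a - e)) (hf : NonInt (a - f)) (hg : NonInt (a - g)) (N k m : ℕ) (hN : k ≤ N) :
    (a + 2 * (k + m : ℕ)) / a * (poch a (k + m) * poch e (k + m) * poch f (k + m) *
      poch g (k + m) * poch (-N) (k + m)) / ((k + m).factorial * poch (1 + a - e) (k + m) *
      poch (1 + a - f) (k + m) * poch (1 + a - g) (k + m) * poch (1 + a + N) (k + m)) *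
      (poch (a - l) (k + m) / poch (1 + l) (k + m)) *
      (poch (a + (k + m : ℕ)) k * poch (-((k + m : ℕ) : ℂ)) k /
        (poch (1 + l - a - (k + m : ℕ)) k * poch (1 + l + (k + m : ℕ)) k)) =
    poch (1 + a) (2 * k) * poch e k * poch f k * poch g k * poch (-N) k /
      (poch (1 + l) (2 * k) * poch (1 + a - e) k * poch (1 + a - f) k * poch (1 + a - g) k *
        poch (1 + a + N) k) *
      dougallTerm (a + 2 * k) (e + k) (f + k) (g + k) (a - l) (N - k) m := by
  have s1 : poch (a + (k + m : ℕ)) k = poch a (2 * k) * poch (a + 2 * k) m / poch a (k + m) := by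
    rw [eq_div_iff (ha.poch_ne_zero _), mul_comm, ← poch_add,
      show k + m + k = 2 * k + m by ring, poch_add]
    push_cast; rfl
  have hl1 : NonInt (1 + l) := hl.of_eq_add 1 (by push_cast; ring)
  have s2 : poch (1 + l + (k + m : ℕ)) k =
      poch (1 + l) (2 * k) * poch (1 + l + 2 * k) m / poch (1 + l) (k + m) := by
    rw [eq_div_iff (hl1.poch_ne_zero _), mul_comm, ← poch_add,
      show k + m + k = 2 * k + m by ring, poch_add]
    push_cast; rfl
  have s3 : poch (1 + l - a - (k + m : ℕ)) k =
      (-1) ^ k * poch (a - l) (k + m) / poch (a - l) m := by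
    rw [eq_div_iff (hal.poch_ne_zero _), show 1 + l - a - ((k + m : ℕ) : ℂ) =
      1 - (a - l + m) - k by push_cast; ring, poch_reflect, add_comm k m, poch_add]
    ring
  have s4 : poch (1 + a) (2 * k) = poch a (2 * k) * (a + 2 * k) / a := by
    have := poch_succ' a (2 * k)
    rw [poch_succ] at this
    push_cast at this
    rw [eq_div_iff ha.ne_zero, add_comm 1 a]
    linear_combination -this
  have n1 : a + 2 * (k : ℂ) ≠ 0 := (ha.of_eq_add (2 * k) (by push_cast; ring)).ne_zero
  have n2 := ha.poch_ne_zero (k + m)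
  have n3 := hl1.poch_ne_zero (k + m)
  have n4 := hal.poch_ne_zero (k + m)
  have n5 := hal.poch_ne_zero m
  have n6 : (-1 : ℂ) ^ k ≠ 0 := by simp
  have n7 : poch (1 + l + 2 * k) m ≠ 0 :=
    (hl1.of_eq_add (2 * k) (by push_cast; ring)).poch_ne_zero m
  have n8 := hl1.poch_ne_zero (2 * k)
  have n9 := factorial_ne m
  have n10 := factorial_ne (k + m)
  have n11 := ha.ne_zero
  have q1 : ∀ x : ℂ, NonInt (a - x) → poch (1 + a - x) (k + m) ≠ 0 ∧ poch (1 + a - x) (k + m) =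
      poch (1 + a - x) k * poch (1 + (a + 2 * k) - (x + k)) m := by
    intro x hx
    refine ⟨(hx.of_eq_add 1 (by push_cast; ring)).poch_ne_zero _, ?_⟩
    rw [poch_add]
    congr 2
    ring
  have q2 : poch (1 + a + N) (k + m) =
      poch (1 + a + N) k * poch (1 + (a + 2 * k) + (N - k : ℕ)) m := by
    rw [poch_add]
    congr 2
    push_cast [hN]
    ring
  have q3 : poch (-N : ℂ) (k + m) = poch (-N : ℂ) k * poch (-((N - k : ℕ) : ℂ)) m := by
    rw [poch_add]
    congr 2
    push_cast [hN]
    ring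
  have q4 : poch (1 + a + N) (k + m) ≠ 0 :=
    (ha.of_eq_add (1 + N) (by push_cast; ring)).poch_ne_zero _
  obtain ⟨e1, e2⟩ := q1 e he
  obtain ⟨f1, f2⟩ := q1 f hf
  obtain ⟨g1, g2⟩ := q1 g hg
  rw [e2] at e1
  rw [f2] at f1
  rw [g2] at g1
  rw [q2] at q4
  rw [dougallTerm, s1, s2, s3, s4, poch_neg_nat, e2, f2, g2, q2, q3, poch_add e, poch_add f,
    poch_add g, show 1 + (a + 2 * k) - (a - l) = 1 + l + 2 * k by ring]
  have p1 := left_ne_zero_of_mul e1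
  have p2 := right_ne_zero_of_mul e1
  have p3 := left_ne_zero_of_mul f1
  have p4 := right_ne_zero_of_mul f1
  have p5 := left_ne_zero_of_mul g1
  have p6 := right_ne_zero_of_mul g1
  have p7 := left_ne_zero_of_mul q4
  have p8 := right_ne_zero_of_mul q4
  clear s1 s2 s3 s4 q1 q2 q3 e1 e2 f1 f2 g1 g2 q4 he hf hg hal hl ha hl1
  push_cast
  rw [show a + 2 * ((k : ℂ) + m) = a + 2 * k + 2 * m by ring]
  generalize a + 2 * (k : ℂ) + 2 * m = A at *
  generalize (-1 : ℂ) ^ k = s at *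
  generalize poch (a - l) (k + m) = x1 at *
  generalize poch (a - l) m = x2 at *
  generalize poch (1 + l) (k + m) = x3 at *
  generalize poch a (k + m) = x4 at *
  generalize poch (1 + l) (2 * k) = x5 at *
  generalize poch (1 + l + 2 * k) m = x6 at *
  generalize ((k + m).factorial : ℂ) = x7 at *
  generalize (m.factorial : ℂ) = x8 at *
  generalize poch (1 + a - e) k = x9 at *
  generalize poch (1 + a - f) k = x10 at *
  generalize poch (1 + a - g) k = x11 at *
  generalize poch (1 + (a + 2 * (k : ℂ)) - (e + k)) m = x12 at *
  generalize poch (1 + (a + 2 * (k : ℂ)) - (f + k)) m = x13 at *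
  generalize poch (1 + (a + 2 * (k : ℂ)) - (g + k)) m = x14 at *
  generalize poch (1 + a + N) k = x15 at *
  generalize poch (1 + (a + 2 * (k : ℂ)) + (N - k : ℕ)) m = x16 at *
  generalize poch a (2 * k) = x17 at *
  generalize poch (a + 2 * k) m = x18 at *
  generalize a + 2 * (k : ℂ) = A' at *
  generalize poch (e + k) m = y1 at *
  generalize poch (f + k) m = y2 at *
  generalize poch (g + k) m = y3 at *
  generalize poch e k = y4 at *
  generalize poch f k = y5 at *
  generalize poch g k = y6 at *
  generalize poch (-(N : ℂ)) k = y7 at *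
  generalize poch (-((N - k : ℕ) : ℂ)) m = y8 at *
  field_simp

/-- Summing the inner series in Bailey's transformation by Dougall's formula. -/
lemma bailey_inner_sum (a e f g l : ℂ) (ha : NonInt a) (hl : NonInt l)
    (he : NonInt (a - e)) (hf : NonInt (a - f)) (hg : NonInt (a - g)) (hle : NonInt (l - e))
    (hlf : NonInt (l - f)) (hlg : NonInt (l - g)) (N k : ℕ) (hN : k ≤ N)
    (hbal : a - l = 1 + 2 * a + N - e - f - g) :
    poch (1 + a) (2 * k) /
      (poch (1 + l) (2 * k) * poch (1 + a - e) k * poch (1 + a - f) k * poch (1 + a - g) k *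
        poch (1 + a + N) k) * ∑ m ∈ Finset.range (N - k + 1),
      dougallTerm (a + 2 * k) (e + k) (f + k) (g + k) (a - l) (N - k) m =
    poch (1 + a) N * poch (1 + l - e) N * poch (1 + l - f) N * poch (1 + l - g) N /
      (poch (1 + l) N * poch (1 + a - e) N * poch (1 + a - f) N * poch (1 + a - g) N) /
      (poch (1 + l - e) k * poch (1 + l - f) k * poch (1 + l - g) k * poch (1 + l + N) k) := by
  obtain ⟨M, rfl⟩ := Nat.exists_eq_add_of_le hN
  have hE : a - l = 1 + 2 * (a + 2 * k) + (k + M - k : ℕ) - (e + k) - (f + k) - (g + k) := by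
    rw [hbal]
    push_cast [Nat.le_add_right k M]
    ring
  rw [hE, dougall (a + 2 * k) (e + k) (f + k) (g + k) (ha.of_eq_add (2 * k) (by push_cast; ring))
    (he.of_eq_add k (by push_cast; ring)) (hf.of_eq_add k (by push_cast; ring))
    (hg.of_eq_add k (by push_cast; ring)) (hl.of_eq_sub (-(k + M) - k - 1)
      (by push_cast at hbal ⊢; linear_combination -hbal))]
  rw [Nat.add_sub_cancel_left]
  have r : ∀ x y z : ℂ, NonInt (l - z) → 1 + l - z = 1 - (1 + a - x - y) - (k + M : ℕ) →
      poch (1 + (a + 2 * k) - (x + k) - (y + k)) M =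
        (-1) ^ M * poch (1 + l - z) (k + M) / poch (1 + l - z) k := by
    intro x y z hz h
    rw [eq_div_iff ((hz.of_eq_add 1 (by push_cast; ring)).poch_ne_zero k), poch_add,
      show 1 + (a + 2 * k) - (x + k) - (y + k) = 1 - (1 + l - z + k) - M by
        rw [h]; push_cast; ring, poch_reflect]
    ring
  push_cast at hbal
  have hl1 : NonInt (1 + l) := hl.of_eq_add 1 (by push_cast; ring)
  have ha1 : NonInt (1 + a) := ha.of_eq_add 1 (by push_cast; ring)
  have r4 : poch (1 + (a + 2 * k) - (e + k) - (f + k) - (g + k)) M =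
        (-1) ^ M * poch (1 + l) (k + M) * poch (1 + l + (k + M : ℕ)) k / poch (1 + l) (2 * k) := by
    rw [eq_div_iff (hl1.poch_ne_zero _), mul_assoc, ← poch_add,
      show k + M + k = 2 * k + M by ring, poch_add,
      show 1 + (a + 2 * k) - (e + k) - (f + k) - (g + k) = 1 - (1 + l + (2 * k : ℕ)) - M by
        push_cast; linear_combination -hbal, poch_reflect]
    ring
  have r5 : poch (1 + (a + 2 * k)) M =
      poch (1 + a) (k + M) * poch (1 + a + (k + M : ℕ)) k / poch (1 + a) (2 * k) := by
    rw [eq_div_iff (ha1.poch_ne_zero _), ← poch_add,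
      show k + M + k = 2 * k + M by ring, poch_add]
    rw [mul_comm, show 1 + (a + 2 * k) = 1 + a + (2 * k : ℕ) by push_cast; ring]
  have q : ∀ x : ℂ, NonInt (a - x) → poch (1 + (a + 2 * k) - (x + k)) M =
      poch (1 + a - x) (k + M) / poch (1 + a - x) k := by
    intro x hx
    rw [eq_div_iff ((hx.of_eq_add 1 (by push_cast; ring)).poch_ne_zero k), poch_add, mul_comm]
    congr 2
    ring
  rw [r e f g hlg (by push_cast; linear_combination -hbal),
    r e g f hlf (by push_cast; linear_combination -hbal),
    r f g e hle (by push_cast; linear_combination -hbal), r4, r5, q e he, q f hf, q g hg]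
  have m1 : ∀ j, poch (1 + l - e) j ≠ 0 := (hle.of_eq_add 1 (by push_cast; ring)).poch_ne_zero
  have m2 : ∀ j, poch (1 + l - f) j ≠ 0 := (hlf.of_eq_add 1 (by push_cast; ring)).poch_ne_zero
  have m3 : ∀ j, poch (1 + l - g) j ≠ 0 := (hlg.of_eq_add 1 (by push_cast; ring)).poch_ne_zero
  have m4 : ∀ j, poch (1 + a - e) j ≠ 0 := (he.of_eq_add 1 (by push_cast; ring)).poch_ne_zero
  have m5 : ∀ j, poch (1 + a - f) j ≠ 0 := (hf.of_eq_add 1 (by push_cast; ring)).poch_ne_zero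
  have m6 : ∀ j, poch (1 + a - g) j ≠ 0 := (hg.of_eq_add 1 (by push_cast; ring)).poch_ne_zero
  have m7 : poch (1 + a + (k + M : ℕ)) k ≠ 0 :=
    (ha1.of_eq_add (k + M) (by push_cast; ring)).poch_ne_zero _
  have m8 : poch (1 + l + (k + M : ℕ)) k ≠ 0 :=
    (hl1.of_eq_add (k + M) (by push_cast; ring)).poch_ne_zero _
  have m9 := hl1.poch_ne_zero
  have m10 := ha1.poch_ne_zero (2 * k)
  have s2 : ((-1 : ℂ) ^ M) ^ 2 = 1 := by rw [← pow_mul, mul_comm, pow_mul]; simp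
  have s0 : (-1 : ℂ) ^ M ≠ 0 := by simp
  have z1 := m1 k
  have z2 := m2 k
  have z3 := m3 k
  have z4 := m4 k
  have z5 := m5 k
  have z6 := m6 k
  have y1 := m1 (k + M)
  have y2 := m2 (k + M)
  have y3 := m3 (k + M)
  have y4 := m4 (k + M)
  have y5 := m5 (k + M)
  have y6 := m6 (k + M)
  have w1 := m9 (2 * k)
  have w2 := m9 (k + M)
  clear m1 m2 m3 m4 m5 m6 m9 r r4 r5 q hE hbal
  generalize poch (1 + l - e) k = v1 at *
  generalize poch (1 + l - f) k = v2 at *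
  generalize poch (1 + l - g) k = v3 at *
  generalize poch (1 + a - e) k = v4 at *
  generalize poch (1 + a - f) k = v5 at *
  generalize poch (1 + a - g) k = v6 at *
  generalize poch (1 + l - e) (k + M) = u1 at *
  generalize poch (1 + l - f) (k + M) = u2 at *
  generalize poch (1 + l - g) (k + M) = u3 at *
  generalize poch (1 + a - e) (k + M) = u4 at *
  generalize poch (1 + a - f) (k + M) = u5 at *
  generalize poch (1 + a - g) (k + M) = u6 at *
  generalize poch (1 + a + (k + M : ℕ)) k = t1 at *
  generalize poch (1 + l + (k + M : ℕ)) k = t2 at *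
  generalize poch (1 + l) (2 * k) = t3 at *
  generalize poch (1 + l) (k + M) = t4 at *
  generalize poch (1 + a) (2 * k) = t5 at *
  generalize poch (1 + a) (k + M) = t6 at *
  generalize (-1 : ℂ) ^ M = s at *
  field_simp
  linear_combination t6 * s2

/-- Bailey's transformation of the terminating very-well-poised `₉F₈(1)`. -/
lemma bailey (a b c d e f g l : ℂ) (N : ℕ) (hl' : l = 1 + 2 * a - b - c - d)
    (hbal : a - l = 1 + 2 * a + N - e - f - g)
    (ha : NonInt a) (hl : NonInt l) (hal : NonInt (a - l)) (hb : NonInt (a - b))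
    (hc : NonInt (a - c)) (hd : NonInt (a - d))
    (he : NonInt (a - e)) (hf : NonInt (a - f)) (hg : NonInt (a - g)) (hle : NonInt (l - e))
    (hlf : NonInt (l - f)) (hlg : NonInt (l - g)) :
    ∑ n ∈ Finset.range (N + 1), baileyTerm a b c d e f g N n =
    poch (1 + a) N * poch (1 + l - e) N * poch (1 + l - f) N * poch (1 + l - g) N /
      (poch (1 + l) N * poch (1 + a - e) N * poch (1 + a - f) N * poch (1 + a - g) N) *
    ∑ k ∈ Finset.range (N + 1),
      baileyTerm l (l + b - a) (l + c - a) (l + d - a) e f g N k := by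
  have hl1 : NonInt (1 + l) := hl.of_eq_add 1 (by push_cast; ring)
  have hD : ∀ n, poch b n * poch c n * poch d n /
      (poch (1 + a - b) n * poch (1 + a - c) n * poch (1 + a - d) n) =
      poch (a - l) n / poch (1 + l) n * ∑ k ∈ Finset.range (n + 1),
        dougallTerm l (l + b - a) (l + c - a) (l + d - a) (a + n) n k := by
    intro n
    have h := dougall l (l + b - a) (l + c - a) (l + d - a) hl
      (hb.of_eq_add 0 (by push_cast; ring)) (hc.of_eq_add 0 (by push_cast; ring))
      (hd.of_eq_add 0 (by push_cast; ring))
      (hal.of_eq_add (-1) (by push_cast; rw [hl']; ring)) n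
    rw [show 1 + 2 * l + n - (l + b - a) - (l + c - a) - (l + d - a) = a + n by rw [hl']; ring,
      show 1 + l - (l + b - a) - (l + c - a) - (l + d - a) = a - l by rw [hl']; ring,
      show 1 + l - (l + b - a) - (l + c - a) = d by rw [hl']; ring,
      show 1 + l - (l + b - a) - (l + d - a) = c by rw [hl']; ring,
      show 1 + l - (l + c - a) - (l + d - a) = b by rw [hl']; ring,
      show 1 + l - (l + b - a) = 1 + a - b by ring, show 1 + l - (l + c - a) = 1 + a - c by ring,
      show 1 + l - (l + d - a) = 1 + a - d by ring] at h
    have n1 := hl1.poch_ne_zero n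
    have n2 := hal.poch_ne_zero n
    have n3 := (hb.of_eq_add 1 (by push_cast; ring) : NonInt (1 + a - b)).poch_ne_zero n
    have n4 := (hc.of_eq_add 1 (by push_cast; ring) : NonInt (1 + a - c)).poch_ne_zero n
    have n5 := (hd.of_eq_add 1 (by push_cast; ring) : NonInt (1 + a - d)).poch_ne_zero n
    rw [h]
    clear h
    generalize poch (1 + a - b) n = v1 at *
    generalize poch (1 + a - c) n = v2 at *
    generalize poch (1 + a - d) n = v3 at *
    generalize poch (a - l) n = v4 at *
    generalize poch (1 + l) n = v5 at *
    field_simp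
  have h1 : ∀ n, baileyTerm a b c d e f g N n = ∑ k ∈ Finset.range (n + 1),
      (a + 2 * n) / a * (poch a n * poch e n * poch f n * poch g n * poch (-N) n) /
        (n.factorial * poch (1 + a - e) n * poch (1 + a - f) n * poch (1 + a - g) n *
          poch (1 + a + N) n) * (poch (a - l) n / poch (1 + l) n) *
        dougallTerm l (l + b - a) (l + c - a) (l + d - a) (a + n) n k := by
    intro n
    rw [← Finset.mul_sum, mul_assoc, ← hD, baileyTerm]
    simp only [div_eq_mul_inv, mul_inv]
    ring
  have h2 : ∀ k n : ℕ, dougallTerm l (l + b - a) (l + c - a) (l + d - a) (a + n) n k =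
      (l + 2 * k) / l * (poch l k * poch (l + b - a) k * poch (l + c - a) k *
        poch (l + d - a) k) / (k.factorial * poch (1 + a - b) k * poch (1 + a - c) k *
        poch (1 + a - d) k) * (poch (a + n) k * poch (-n) k /
        (poch (1 + l - a - n) k * poch (1 + l + n) k)) := by
    intro k n
    rw [dougallTerm,
      show 1 + l - (l + b - a) = 1 + a - b by ring, show 1 + l - (l + c - a) = 1 + a - c by ring,
      show 1 + l - (l + d - a) = 1 + a - d by ring, show 1 + l - (a + n) = 1 + l - a - n by ring]
    simp only [div_eq_mul_inv, mul_inv]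
    ring
  rw [Finset.sum_congr rfl fun n _ => h1 n, Finset.sum_comm' (t' := Finset.range (N + 1))
    (s' := fun k => Finset.Ico k (N + 1)) (by simp; omega), Finset.mul_sum]
  refine Finset.sum_congr rfl fun k hk => ?_
  have hkN : k ≤ N := by simpa [Nat.lt_succ_iff] using hk
  rw [Finset.sum_Ico_eq_sum_range, show N + 1 - k = N - k + 1 by omega]
  have h3 := fun m => bailey_inner_term a e f g l ha hl hal he hf hg N k m hkN
  have h4 := bailey_inner_sum a e f g l ha hl he hf hg hle hlf hlg N k hkN hbal
  calc _ = ∑ m ∈ Finset.range (N - k + 1), (l + 2 * k) / l * (poch l k * poch (l + b - a) k *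
        poch (l + c - a) k * poch (l + d - a) k) / (k.factorial * poch (1 + a - b) k *
        poch (1 + a - c) k * poch (1 + a - d) k) *
        (poch (1 + a) (2 * k) * poch e k * poch f k * poch g k * poch (-N) k /
      (poch (1 + l) (2 * k) * poch (1 + a - e) k * poch (1 + a - f) k * poch (1 + a - g) k *
        poch (1 + a + N) k) *
      dougallTerm (a + 2 * k) (e + k) (f + k) (g + k) (a - l) (N - k) m) := by
        refine Finset.sum_congr rfl fun m _ => ?_
        rw [← h3 m, h2]
        ring
    _ = (l + 2 * k) / l * (poch l k * poch (l + b - a) k * poch (l + c - a) k *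
        poch (l + d - a) k) / (k.factorial * poch (1 + a - b) k * poch (1 + a - c) k *
        poch (1 + a - d) k) * (poch e k * poch f k * poch g k * poch (-N) k) *
        (poch (1 + a) (2 * k) /
      (poch (1 + l) (2 * k) * poch (1 + a - e) k * poch (1 + a - f) k * poch (1 + a - g) k *
        poch (1 + a + N) k) * ∑ m ∈ Finset.range (N - k + 1),
      dougallTerm (a + 2 * k) (e + k) (f + k) (g + k) (a - l) (N - k) m) := by
        rw [← Finset.mul_sum, ← Finset.mul_sum]
        ring
    _ = _ := by
        rw [h4, baileyTerm,
          show 1 + l - (l + b - a) = 1 + a - b by ring,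
          show 1 + l - (l + c - a) = 1 + a - c by ring,
          show 1 + l - (l + d - a) = 1 + a - d by ring]
        simp only [div_eq_mul_inv, mul_inv]
        ring

lemma poch_sub_mul (y : ℂ) (k j : ℕ) :
    poch (y - (k + j : ℕ)) k * poch (1 - y) j = (-1) ^ k * poch (1 - y) (k + j) := by
  rw [show y - ((k + j : ℕ) : ℂ) = 1 - (1 - y + j) - k by push_cast; ring, poch_reflect, add_comm k,
    poch_add]
  ring

/-- The terms of the symmetrized form of a terminating `₉F₈(1)`. -/
def omegaTerm (x₁ x₂ x₃ x₄ e f g : ℂ) (k j : ℕ) : ℂ :=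
  (j - k + 1 - e) / (1 - e) *
    (poch x₁ k * poch x₂ k * poch x₃ k * poch x₄ k * (poch (1 + x₁ - e) j * poch (1 + x₂ - e) j *
      poch (1 + x₃ - e) j * poch (1 + x₄ - e) j)) /
    (k.factorial * poch e k * poch f k * poch g k *
      (j.factorial * poch (2 - e) j * poch (1 + f - e) j * poch (1 + g - e) j))

lemma baileyTerm_eq_omegaTerm (x₁ x₂ x₃ x₄ e f g : ℂ) (k j : ℕ) (he : NonInt e)
    (h1 : NonInt (x₁ - e)) (h2 : NonInt (x₂ - e)) (h3 : NonInt (x₃ - e)) (h4 : NonInt (x₄ - e))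
    (hf : NonInt (f - e)) (hg : NonInt (g - e)) (N : ℕ) (hN : k + j = N) :
    baileyTerm (e - 1 - N) x₁ x₂ (e - N - f) x₃ x₄ (e - N - g) N k =
      N.factorial * poch (1 - e) N * poch (1 + f - e) N * poch (1 + g - e) N /
        (poch (1 + x₁ - e) N * poch (1 + x₂ - e) N * poch (1 + x₃ - e) N * poch (1 + x₄ - e) N) *
      omegaTerm x₁ x₂ x₃ x₄ e f g k j := by
  have hs : (-1 : ℂ) ^ k ≠ 0 := by simp
  have den : ∀ x : ℂ, NonInt (x - e) → poch (1 + (e - 1 - N) - x) k =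
      (-1) ^ k * poch (1 + x - e) N / poch (1 + x - e) j := by
    intro x hx
    have := poch_sub_mul (e - x) k j
    rw [hN, show 1 - (e - x) = 1 + x - e by ring] at this
    rw [eq_div_iff ((hx.of_eq_add 1 (by push_cast; ring)).poch_ne_zero j), ← this]
    congr 2
    ring
  have num : ∀ x : ℂ, NonInt (x - e) → poch (e - N - x) k =
      (-1) ^ k * poch (1 + x - e) N / poch (1 + x - e) j := by
    intro x hx
    rw [← den x hx]
    congr 1
    ring
  have he1 : NonInt (1 - e) := he.of_eq_sub 1 (by push_cast; ring)
  have he2 : NonInt (2 - e) := he.of_eq_sub 2 (by push_cast; ring)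
  have t1 : poch (e - 1 - N) k = (-1) ^ k * poch (2 - e) N / poch (2 - e) j := by
    have := poch_sub_mul (e - 1) k j
    rw [hN, show 1 - (e - 1) = 2 - e by ring] at this
    rw [eq_div_iff (he2.poch_ne_zero j), ← this]
  have t2 : poch (2 - e) N = poch (1 - e) N * (1 - e + N) / (1 - e) := by
    rw [eq_div_iff he1.ne_zero, ← poch_succ, poch_succ', mul_comm, show 1 - e + 1 = 2 - e by ring]
  have t3 : poch (-N) k = (-1) ^ k * N.factorial / j.factorial := by
    rw [← hN, poch_neg_nat]
  have u : ∀ x : ℂ, NonInt (x - e) → ∀ i, poch (1 + x - e) i ≠ 0 := fun x hx i =>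
    (hx.of_eq_add 1 (by push_cast; ring)).poch_ne_zero i
  rw [baileyTerm, omegaTerm, den _ h1, den _ h2, den _ h3, den _ h4, num f hf, num g hg, t1, t2, t3,
    show 1 + (e - 1 - N) - (e - N - f) = f by ring, show 1 + (e - 1 - N) - (e - N - g) = g by ring,
    show 1 + (e - 1 - N) + N = e by ring]
  have n1 := u _ h1 j
  have n2 := u _ h2 j
  have n3 := u _ h3 j
  have n4 := u _ h4 j
  have n5 := u _ hf j
  have n6 := u _ hg j
  have m1 := u _ h1 N
  have m2 := u _ h2 N
  have m3 := u _ h3 N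
  have m4 := u _ h4 N
  have q1 := he2.poch_ne_zero j
  have q2 := he1.ne_zero
  have q3 : e - 1 - N ≠ 0 := (he.of_eq_add (-1 - N) (by push_cast; ring)).ne_zero
  have q4 := factorial_ne j
  have q5 := factorial_ne k
  have e1 : (j : ℂ) - k + 1 - e = -(e - 1 - N + 2 * k) := by rw [← hN]; push_cast; ring
  have e2 : 1 - e + (N : ℂ) = -(e - 1 - N) := by ring
  rw [e1, e2]
  clear den num t1 t2 t3 u e1 e2 h1 h2 h3 h4 hf hg hN
  simp only [div_eq_mul_inv, mul_inv, inv_inv]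
  generalize poch (1 + x₁ - e) j = a1 at *
  generalize poch (1 + x₂ - e) j = a2 at *
  generalize poch (1 + x₃ - e) j = a3 at *
  generalize poch (1 + x₄ - e) j = a4 at *
  generalize poch (1 + x₁ - e) N = b1 at *
  generalize poch (1 + x₂ - e) N = b2 at *
  generalize poch (1 + x₃ - e) N = b3 at *
  generalize poch (1 + x₄ - e) N = b4 at *
  generalize poch (1 + f - e) N = b5 at *
  generalize poch (1 + g - e) N = b6 at *
  generalize poch (1 + f - e) j = a5 at *
  generalize poch (1 + g - e) j = a6 at *
  generalize poch (2 - e) j = a7 at *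
  generalize e - 1 - (N : ℂ) + 2 * k = A at *
  generalize e - 1 - (N : ℂ) = B at *
  generalize 1 - e = E at *
  generalize ((-1 : ℂ)) ^ k = s at *
  have c1 : B * B⁻¹ = 1 := mul_inv_cancel₀ q3
  have c2 : s * s⁻¹ = 1 := mul_inv_cancel₀ hs
  have c3 : (s * s⁻¹) ^ 4 * (B * B⁻¹) = 1 := by rw [c1, c2]; simp
  generalize s⁻¹ = s' at *
  generalize B⁻¹ = B' at *
  linear_combination -(A * poch E N * E⁻¹ * a7⁻¹ * poch x₁ k * poch x₂ k * b5 * a5⁻¹ *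
    poch x₃ k * poch x₄ k * b6 * a6⁻¹ * N.factorial * (j.factorial : ℂ)⁻¹ * (k.factorial : ℂ)⁻¹ *
    b1⁻¹ * a1 * b2⁻¹ * a2 * (poch f k)⁻¹ * b3⁻¹ * a3 * b4⁻¹ * a4 * (poch g k)⁻¹ *
    (poch e k)⁻¹) * c3

/-- The symmetrized form of a terminating very-well-poised `₉F₈(1)`. -/
def omegaSum (x₁ x₂ x₃ x₄ e f g : ℂ) (N : ℕ) : ℂ :=
  ∑ p ∈ Finset.HasAntidiagonal.antidiagonal N, omegaTerm x₁ x₂ x₃ x₄ e f g p.1 p.2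

lemma sum_baileyTerm_eq_omegaSum (x₁ x₂ x₃ x₄ e f g : ℂ) (he : NonInt e)
    (h1 : NonInt (x₁ - e)) (h2 : NonInt (x₂ - e)) (h3 : NonInt (x₃ - e)) (h4 : NonInt (x₄ - e))
    (hf : NonInt (f - e)) (hg : NonInt (g - e)) (N : ℕ) :
    ∑ k ∈ Finset.range (N + 1), baileyTerm (e - 1 - N) x₁ x₂ (e - N - f) x₃ x₄ (e - N - g) N k =
      N.factorial * poch (1 - e) N * poch (1 + f - e) N * poch (1 + g - e) N /
        (poch (1 + x₁ - e) N * poch (1 + x₂ - e) N * poch (1 + x₃ - e) N * poch (1 + x₄ - e) N) *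
      omegaSum x₁ x₂ x₃ x₄ e f g N := by
  rw [← Finset.Nat.sum_antidiagonal_eq_sum_range_succ (fun k _ =>
    baileyTerm (e - 1 - N) x₁ x₂ (e - N - f) x₃ x₄ (e - N - g) N k), omegaSum, Finset.mul_sum]
  exact Finset.sum_congr rfl fun p hp => baileyTerm_eq_omegaTerm x₁ x₂ x₃ x₄ e f g p.1 p.2 he h1 h2
    h3 h4 hf hg N (Finset.HasAntidiagonal.mem_antidiagonal.1 hp)

set_option maxHeartbeats 1000000 in
/-- The transformation of `omegaSum` obtained from two applications of Bailey's transformation,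
for parameters in general position. -/
lemma omegaSum_transform_generic (x₁ x₂ x₃ x₄ e f g : ℂ) (hs : e + f + g = x₁ + x₂ + x₃ + x₄ + 1)
    (he : NonInt e) (hf : NonInt f) (hg : NonInt g)
    (h1 : NonInt (x₁ - e)) (h2 : NonInt (x₂ - e)) (h3 : NonInt (x₃ - e)) (h4 : NonInt (x₄ - e))
    (g1 : NonInt (x₁ - g)) (g2 : NonInt (x₂ - g)) (g3 : NonInt (x₃ - g)) (g4 : NonInt (x₄ - g))
    (hfe : NonInt (f - e)) (hge : NonInt (g - e)) (hfg : NonInt (f - g))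
    (hfx : NonInt (f - x₁ - x₂)) (hfx' : NonInt (f - x₃ - x₄)) (hefx : NonInt (e + f - x₁ - x₂))
    (hgfx : NonInt (g + f - x₁ - x₂)) (N : ℕ) :
    omegaSum x₁ x₂ x₃ x₄ e f g N =
      omegaSum (f - x₄) (f - x₃) (f - x₂) (f - x₁) (1 + f - g) f (1 + f - e) N := by
  have H1 := sum_baileyTerm_eq_omegaSum x₁ x₂ x₃ x₄ e f g he h1 h2 h3 h4 hfe hge N
  have H2 := sum_baileyTerm_eq_omegaSum (f - x₄) (f - x₃) (f - x₂) (f - x₁) (1 + f - g) f (1 + f - e)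
    (hfg.of_eq_add 1 (by push_cast; ring)) (g4.of_eq_sub (-1) (by push_cast; ring))
    (g3.of_eq_sub (-1) (by push_cast; ring)) (g2.of_eq_sub (-1) (by push_cast; ring))
    (g1.of_eq_sub (-1) (by push_cast; ring)) (hg.of_eq_add (-1) (by push_cast; ring))
    (hge.of_eq_add 0 (by push_cast; ring)) N
  have B1 := bailey (e - 1 - N) x₁ x₂ (e - N - f) x₃ x₄ (e - N - g) (e - 1 - N + f - x₁ - x₂) N
    (by ring) (by linear_combination -hs)
    (he.of_eq_add (-1 - N) (by push_cast; ring)) (hefx.of_eq_add (-1 - N) (by push_cast; ring))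
    (hfx.of_eq_sub 0 (by push_cast; ring)) (h1.of_eq_sub (-1 - N) (by push_cast; ring))
    (h2.of_eq_sub (-1 - N) (by push_cast; ring)) (hf.of_eq_add (-1) (by push_cast; ring))
    (h3.of_eq_sub (-1 - N) (by push_cast; ring)) (h4.of_eq_sub (-1 - N) (by push_cast; ring))
    (hg.of_eq_add (-1) (by push_cast; ring))
    (g4.of_eq_add (-N) (by push_cast; linear_combination hs))
    (g3.of_eq_add (-N) (by push_cast; linear_combination hs))
    (hgfx.of_eq_add (-1) (by push_cast; ring))
  have B2 := bailey (e - 1 - N + f - x₁ - x₂) x₃ x₄ (e - N - x₁ - x₂) (f - x₂) (f - x₁) (e - N - g)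
    (f - g - N) N
    (by linear_combination -hs) (by ring)
    (hefx.of_eq_add (-1 - N) (by push_cast; ring)) (hfg.of_eq_add (-N) (by push_cast; ring))
    (hfx'.of_eq_sub 0 (by push_cast; linear_combination hs))
    (g4.of_eq_add (-N) (by push_cast; linear_combination hs))
    (g3.of_eq_add (-N) (by push_cast; linear_combination hs))
    (hf.of_eq_add (-1) (by push_cast; ring)) (h1.of_eq_sub (-1 - N) (by push_cast; ring))
    (h2.of_eq_sub (-1 - N) (by push_cast; ring)) (hgfx.of_eq_add (-1) (by push_cast; ring))
    (g2.of_eq_add (-N) (by push_cast; ring)) (g1.of_eq_add (-N) (by push_cast; ring))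
    (hfe.of_eq_add 0 (by push_cast; ring))
  have r : ∀ x y : ℂ, x = 1 - y - N → poch x N = (-1) ^ N * poch y N := by
    intro x y h
    rw [h, poch_reflect]
  rw [show e - 1 - N + f - x₁ - x₂ + x₁ - (e - 1 - N) = f - x₂ by ring,
    show e - 1 - N + f - x₁ - x₂ + x₂ - (e - 1 - N) = f - x₁ by ring,
    show e - 1 - N + f - x₁ - x₂ + (e - N - f) - (e - 1 - N) = e - N - x₁ - x₂ by ring] at B1
  rw [show f - g - N + x₃ - (e - 1 - N + f - x₁ - x₂) = f - x₄ by linear_combination -hs,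
    show f - g - N + x₄ - (e - 1 - N + f - x₁ - x₂) = f - x₃ by linear_combination -hs,
    show f - g - N + (e - N - x₁ - x₂) - (e - 1 - N + f - x₁ - x₂) = 1 + f - g - N - f by ring] at B2
  have P : ∀ n, baileyTerm (e - 1 - N + f - x₁ - x₂) (f - x₂) (f - x₁) (e - N - x₁ - x₂) x₃ x₄
      (e - N - g) N n = baileyTerm (e - 1 - N + f - x₁ - x₂) x₃ x₄ (e - N - x₁ - x₂) (f - x₂)
      (f - x₁) (e - N - g) N n := by
    intro n
    rw [baileyTerm, baileyTerm]
    simp only [div_eq_mul_inv, mul_inv]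
    ring
  rw [Finset.sum_congr rfl fun n _ => P n, B2,
    show f - g - N = 1 + f - g - 1 - N by ring,
    show e - N - g = 1 + f - g - N - (1 + f - e) by ring, H2] at B1
  rw [show 1 + f - g - N - (1 + f - e) = e - N - g by ring, H1,
    show 1 + (f - x₄) - (1 + f - g) = g - x₄ by ring, show 1 + (f - x₃) - (1 + f - g) = g - x₃ by ring,
    show 1 + (f - x₂) - (1 + f - g) = g - x₂ by ring, show 1 + (f - x₁) - (1 + f - g) = g - x₁ by ring,
    show 1 + f - (1 + f - g) = g by ring, show 1 + (1 + f - e) - (1 + f - g) = 1 + g - e by ring,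
    show 1 - (1 + f - g) = g - f by ring,
    r (1 + (e - 1 - N)) (1 - e) (by ring),
    r (1 + (e - 1 - N + f - x₁ - x₂) - x₃) (g - x₄) (by linear_combination hs),
    r (1 + (e - 1 - N + f - x₁ - x₂) - x₄) (g - x₃) (by linear_combination hs),
    show 1 + (e - 1 - N + f - x₁ - x₂) - (f - x₂) = 1 + (e - 1 - N) - x₁ by ring,
    show 1 + (e - 1 - N + f - x₁ - x₂) - (f - x₁) = 1 + (e - 1 - N) - x₂ by ring,
    r (1 + (e - 1 - N) - x₁) (1 + x₁ - e) (by ring),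
    r (1 + (e - 1 - N) - x₂) (1 + x₂ - e) (by ring),
    r (1 + (e - 1 - N) - x₃) (1 + x₃ - e) (by ring),
    r (1 + (e - 1 - N) - x₄) (1 + x₄ - e) (by ring),
    show 1 + (e - 1 - N) - (e - N - g) = g by ring,
    r (1 + (1 + f - g - 1 - N) - (f - x₂)) (g - x₂) (by ring),
    r (1 + (1 + f - g - 1 - N) - (f - x₁)) (g - x₁) (by ring),
    r (1 + (1 + f - g - 1 - N)) (g - f) (by ring),
    show 1 + (1 + f - g - 1 - N) - (e - N - g) = 1 + f - e by ring] at B1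
  have n1 := (h1.of_eq_add 1 (by push_cast; ring) : NonInt (1 + x₁ - e)).poch_ne_zero N
  have n2 := (h2.of_eq_add 1 (by push_cast; ring) : NonInt (1 + x₂ - e)).poch_ne_zero N
  have n3 := (h3.of_eq_add 1 (by push_cast; ring) : NonInt (1 + x₃ - e)).poch_ne_zero N
  have n4 := (h4.of_eq_add 1 (by push_cast; ring) : NonInt (1 + x₄ - e)).poch_ne_zero N
  have n5 := (g1.of_eq_sub 0 (by push_cast; ring) : NonInt (g - x₁)).poch_ne_zero N
  have n6 := (g2.of_eq_sub 0 (by push_cast; ring) : NonInt (g - x₂)).poch_ne_zero N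
  have n7 := (g3.of_eq_sub 0 (by push_cast; ring) : NonInt (g - x₃)).poch_ne_zero N
  have n8 := (g4.of_eq_sub 0 (by push_cast; ring) : NonInt (g - x₄)).poch_ne_zero N
  have n9 := hg.poch_ne_zero N
  have n10 := (hfg.of_eq_sub 0 (by push_cast; ring) : NonInt (g - f)).poch_ne_zero N
  have n11 := (he.of_eq_sub 1 (by push_cast; ring) : NonInt (1 - e)).poch_ne_zero N
  have n12 := (hfe.of_eq_add 1 (by push_cast; ring) : NonInt (1 + f - e)).poch_ne_zero N
  have n13 := (hge.of_eq_add 1 (by push_cast; ring) : NonInt (1 + g - e)).poch_ne_zero N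
  have n14 := factorial_ne N
  have n15 : (-1 : ℂ) ^ N ≠ 0 := by simp
  have n16 : poch (1 + (e - 1 - N + f - x₁ - x₂)) N ≠ 0 :=
    (hefx.of_eq_add (-N) (by push_cast; ring)).poch_ne_zero N
  have n17 : poch (1 + (e - 1 - N + f - x₁ - x₂) - (e - N - g)) N ≠ 0 :=
    (hgfx.of_eq_add 0 (by push_cast; ring)).poch_ne_zero N
  clear H1 H2 B2 P r hs he hf hg h1 h2 h3 h4 g1 g2 g3 g4 hfe hge hfg hfx hefx hgfx
  generalize omegaSum x₁ x₂ x₃ x₄ e f g N = Ω at *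
  generalize omegaSum (f - x₄) (f - x₃) (f - x₂) (f - x₁) (1 + f - g) f (1 + f - e) N = Ω' at *
  generalize poch (1 + x₁ - e) N = a1 at *
  generalize poch (1 + x₂ - e) N = a2 at *
  generalize poch (1 + x₃ - e) N = a3 at *
  generalize poch (1 + x₄ - e) N = a4 at *
  generalize poch (g - x₁) N = a5 at *
  generalize poch (g - x₂) N = a6 at *
  generalize poch (g - x₃) N = a7 at *
  generalize poch (g - x₄) N = a8 at *
  generalize poch g N = a9 at *
  generalize poch (g - f) N = a10 at *
  generalize poch (1 - e) N = a11 at *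
  generalize poch (1 + f - e) N = a12 at *
  generalize poch (1 + g - e) N = a13 at *
  generalize (N.factorial : ℂ) = a14 at *
  generalize (-1 : ℂ) ^ N = a15 at *
  generalize poch (1 + (e - 1 - N + f - x₁ - x₂)) N = a16 at *
  generalize poch (1 + (e - 1 - N + f - x₁ - x₂) - (e - N - g)) N = a17 at *
  field_simp at B1
  exact B1

lemma countable_not_nonInt (y c : ℂ) (hc : c ≠ 0) : {s : ℂ | ¬ NonInt (y + c * s)}.Countable := by
  refine (Set.countable_range fun m : ℤ => ((m : ℂ) - y) / c).mono ?_
  intro s hs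
  simp only [NonInt, Set.mem_ofPred_eq, not_forall, not_not] at hs
  obtain ⟨m, hm⟩ := hs
  exact ⟨m, by simp only; rw [← hm]; field_simp; ring⟩

@[fun_prop]
lemma Continuous.poch {X : Type*} [TopologicalSpace X] {u : X → ℂ} (hu : Continuous u) (n : ℕ) :
    Continuous fun s => poch (u s) n := by
  unfold _root_.poch
  fun_prop

lemma Continuous.omegaSum {X : Type*} [TopologicalSpace X] {u₁ u₂ u₃ u₄ : X → ℂ}
    (h₁ : Continuous u₁) (h₂ : Continuous u₂) (h₃ : Continuous u₃) (h₄ : Continuous u₄)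
    (e f g : ℂ) (N : ℕ) :
    Continuous fun s => omegaSum (u₁ s) (u₂ s) (u₃ s) (u₄ s) e f g N := by
  unfold _root_.omegaSum omegaTerm
  refine continuous_finsetSum _ fun p _ => Continuous.div_const ?_ _
  fun_prop

lemma omegaSum_transform (x₁ x₂ x₃ x₄ e f g : ℂ) (hs : e + f + g = x₁ + x₂ + x₃ + x₄ + 1)
    (he : NonInt e) (hf : NonInt f) (hg : NonInt g) (h2 : NonInt (x₂ - e)) (h4 : NonInt (x₄ - e))
    (g2 : NonInt (x₂ - g)) (g4 : NonInt (x₄ - g))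
    (hfe : NonInt (f - e)) (hge : NonInt (g - e)) (hfg : NonInt (f - g)) (N : ℕ) :
    omegaSum x₁ x₂ x₃ x₄ e f g N =
      omegaSum (f - x₄) (f - x₃) (f - x₂) (f - x₁) (1 + f - g) f (1 + f - e) N := by
  let B : Set ℂ := {s | ¬ NonInt (x₁ - e + 1 * s)} ∪ {s | ¬ NonInt (x₁ - g + 1 * s)} ∪
    {s | ¬ NonInt (x₃ - e + (-1) * s)} ∪ {s | ¬ NonInt (x₃ - g + (-1) * s)} ∪
    {s | ¬ NonInt (f - x₁ - x₂ + (-1) * s)} ∪ {s | ¬ NonInt (f - x₃ - x₄ + 1 * s)} ∪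
    {s | ¬ NonInt (e + f - x₁ - x₂ + (-1) * s)} ∪ {s | ¬ NonInt (g + f - x₁ - x₂ + (-1) * s)}
  have hB : B.Countable := by
    simp only [B, Set.countable_union]
    refine ⟨⟨⟨⟨⟨⟨⟨?_, ?_⟩, ?_⟩, ?_⟩, ?_⟩, ?_⟩, ?_⟩, ?_⟩ <;>
      exact countable_not_nonInt _ _ (by simp)
  have key : (fun s : ℂ => omegaSum (x₁ + s) x₂ (x₃ - s) x₄ e f g N) = fun s =>
      omegaSum (f - x₄) (f - (x₃ - s)) (f - x₂) (f - (x₁ + s)) (1 + f - g) f (1 + f - e) N := by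
    refine Continuous.ext_on (hB.dense_compl ℂ)
      (Continuous.omegaSum (by fun_prop) (by fun_prop) (by fun_prop) (by fun_prop) _ _ _ _)
      (Continuous.omegaSum (by fun_prop) (by fun_prop) (by fun_prop) (by fun_prop) _ _ _ _) ?_
    intro s hsB
    simp only [B, Set.compl_union, Set.mem_inter_iff, Set.mem_compl_iff, Set.mem_ofPred_eq,
      not_not] at hsB
    obtain ⟨⟨⟨⟨⟨⟨⟨b1, b2⟩, b3⟩, b4⟩, b5⟩, b6⟩, b7⟩, b8⟩ := hsB
    exact omegaSum_transform_generic (x₁ + s) x₂ (x₃ - s) x₄ e f g (by linear_combination hs) he hf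
      hg (b1.of_eq_add 0 (by push_cast; ring)) h2 (b3.of_eq_add 0 (by push_cast; ring)) h4
      (b2.of_eq_add 0 (by push_cast; ring)) g2 (b4.of_eq_add 0 (by push_cast; ring)) g4 hfe hge hfg
      (b5.of_eq_add 0 (by push_cast; ring)) (b6.of_eq_add 0 (by push_cast; ring))
      (b7.of_eq_add 0 (by push_cast; ring)) (b8.of_eq_add 0 (by push_cast; ring)) N
  simpa using congrFun key 0

lemma tendsto_convolution {u b : ℕ → ℂ} {L : ℂ} (hu : Summable fun k => ‖u k‖)
    (hb : Filter.Tendsto b Filter.atTop (nhds L)) :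
    Filter.Tendsto (fun N => ∑ p ∈ Finset.HasAntidiagonal.antidiagonal N, u p.1 * b p.2)
      Filter.atTop (nhds ((∑' k, u k) * L)) := by
  obtain ⟨C, hC⟩ := (Metric.isBounded_range_of_tendsto b hb).exists_norm_le
  have hC' : ∀ n, ‖b n‖ ≤ C := fun n => hC _ ⟨n, rfl⟩
  have hC0 : 0 ≤ C := (norm_nonneg _).trans (hC' 0)
  rw [← tsum_mul_right]
  have h : Filter.Tendsto (fun N => ∑' k, if k < N + 1 then u k * b (N - k) else 0) Filter.atTop
      (nhds (∑' k, u k * L)) := by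
    refine tendsto_tsum_of_dominated_convergence (hu.mul_right C) (fun k => ?_)
      (Filter.Eventually.of_forall fun N k => ?_)
    · have : Filter.Tendsto (fun N => u k * b (N - k)) Filter.atTop (nhds (u k * L)) :=
        (hb.comp (Filter.tendsto_sub_atTop_nat k)).const_mul _
      refine this.congr' ?_
      filter_upwards [Filter.eventually_ge_atTop k] with N hN
      rw [if_pos (by omega)]
    · split_ifs
      · rw [norm_mul]
        exact mul_le_mul_of_nonneg_left (hC' _) (norm_nonneg _)
      · rw [norm_zero]
        positivity
  refine h.congr fun N => ?_
  rw [Finset.Nat.sum_antidiagonal_eq_sum_range_succ (fun k j => u k * b j),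
    tsum_eq_sum (s := Finset.range (N + 1)) (fun k hk => if_neg (by simpa using hk))]
  exact Finset.sum_congr rfl fun k hk => if_pos (by simpa using hk)

lemma summable_norm_of_tendsto_sq_mul {u : ℕ → ℂ} {L : ℂ}
    (hu : Filter.Tendsto (fun k : ℕ => (k : ℂ) ^ 2 * u k) Filter.atTop (nhds L)) :
    Summable fun k => ‖u k‖ := by
  refine summable_of_isBigO_nat (g := fun n : ℕ => 1 / (n : ℝ) ^ 2)
    (Real.summable_one_div_nat_pow.2 one_lt_two) ?_
  have h := (hu.isBigO_one ℝ).norm_left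
  refine (Asymptotics.IsBigO.mul (Asymptotics.isBigO_refl (fun n : ℕ => 1 / (n : ℝ) ^ 2) _)
    h).congr' ?_ ?_
  · filter_upwards [Filter.eventually_gt_atTop 0] with n hn
    have : (n : ℝ) ≠ 0 := by positivity
    simp only [norm_mul, norm_pow, Complex.norm_natCast]
    field_simp
  · simp

lemma tendsto_zero_of_tendsto_sq_mul {u : ℕ → ℂ} {L : ℂ}
    (hu : Filter.Tendsto (fun k : ℕ => (k : ℂ) ^ 2 * u k) Filter.atTop (nhds L)) :
    Filter.Tendsto (fun k : ℕ => (k : ℂ) * u k) Filter.atTop (nhds 0) := by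
  have h := hu.mul (tendsto_inv_atTop_nhds_zero_nat (𝕜 := ℂ))
  rw [mul_zero] at h
  refine h.congr' ?_
  filter_upwards [Filter.eventually_gt_atTop 0] with n hn
  have : (n : ℂ) ≠ 0 := by exact_mod_cast hn.ne'
  field_simp

lemma sum_antidiagonal_comm (u v : ℕ → ℂ) (N : ℕ) :
    ∑ p ∈ Finset.HasAntidiagonal.antidiagonal N, u p.1 * v p.2 =
      ∑ p ∈ Finset.HasAntidiagonal.antidiagonal N, v p.1 * u p.2 := by
  rw [← Finset.Nat.sum_antidiagonal_swap]
  exact Finset.sum_congr rfl fun p _ => mul_comm _ _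

lemma tendsto_antisymmetric_convolution {u v : ℕ → ℂ} (γ : ℂ)
    (hu : Filter.Tendsto (fun k : ℕ => (k : ℂ) ^ 2 * u k) Filter.atTop (nhds 1))
    (hv : Filter.Tendsto (fun k : ℕ => (k : ℂ) ^ 2 * v k) Filter.atTop (nhds 1)) :
    Filter.Tendsto (fun N : ℕ => (N : ℂ) * ∑ p ∈ Finset.HasAntidiagonal.antidiagonal N,
      ((p.2 : ℂ) - p.1 + γ) * (u p.1 * v p.2)) Filter.atTop (nhds (∑' k, u k - ∑' k, v k)) := by
  have su := summable_norm_of_tendsto_sq_mul hu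
  have sv := summable_norm_of_tendsto_sq_mul hv
  have h := ((tendsto_convolution su hv).sub (tendsto_convolution sv hu)).add
    (((tendsto_convolution sv (tendsto_zero_of_tendsto_sq_mul hu)).add
      (tendsto_convolution su (tendsto_zero_of_tendsto_sq_mul hv))).const_mul γ)
  simp only [mul_one, mul_zero, add_zero] at h
  refine h.congr fun N => ?_
  rw [sum_antidiagonal_comm v fun k => (k : ℂ) ^ 2 * u k,
    sum_antidiagonal_comm v fun k => (k : ℂ) * u k, ← Finset.sum_sub_distrib,
    ← Finset.sum_add_distrib, Finset.mul_sum, ← Finset.sum_add_distrib, Finset.mul_sum]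
  refine Finset.sum_congr rfl fun p hp => ?_
  rw [← Finset.HasAntidiagonal.mem_antidiagonal.1 hp]
  push_cast
  ring

lemma Gamma_add_nat {z : ℂ} (hz : NonInt z) (n : ℕ) : Gamma (n + z) = Gamma z * poch z n := by
  induction n with
  | zero => simp
  | succ n ih =>
    have h : (n : ℂ) + z ≠ 0 := (hz.of_eq_add n (by push_cast; ring)).ne_zero
    rw [poch_succ, show ((n + 1 : ℕ) : ℂ) + z = n + z + 1 by push_cast; ring, Gamma_add_one _ h, ih]
    ring

lemma NonInt.Gamma_ne_zero {z : ℂ} (hz : NonInt z) : Gamma z ≠ 0 :=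
  Complex.Gamma_ne_zero fun m h => hz (-m) (by push_cast; exact h)

lemma tendsto_Gamma_add_nat {z : ℂ} (hz : NonInt z) :
    Filter.Tendsto (fun n : ℕ => Gamma (n + z) / (n.factorial * (n : ℂ) ^ (z - 1))) Filter.atTop
      (nhds 1) := by
  have h1 := (GammaSeq_tendsto_Gamma z).inv₀ hz.Gamma_ne_zero
  have h2 : Filter.Tendsto (fun n : ℕ => (n : ℂ) / (n + z)) Filter.atTop (nhds 1) := by
    have := tendsto_natCast_div_add_atTop (𝕜 := ℂ) z
    exact this
  have h := (h1.const_mul (Gamma z)).mul h2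
  rw [mul_inv_cancel₀ hz.Gamma_ne_zero, mul_one] at h
  refine h.congr' ?_
  filter_upwards [Filter.eventually_gt_atTop 0] with n hn
  have hn0 : (n : ℂ) ≠ 0 := by exact_mod_cast hn.ne'
  have hp : ∏ j ∈ Finset.range (n + 1), (z + j) = poch z n * (z + n) := by
    rw [← poch_succ, poch]
  have h0 : (n : ℂ) + z ≠ 0 := (hz.of_eq_add n (by push_cast; ring)).ne_zero
  have h3 : (n : ℂ) ^ (z - 1) ≠ 0 := by simp [cpow_eq_zero_iff, hn0]
  have h4 := factorial_ne n
  rw [GammaSeq, hp, Gamma_add_nat hz, add_comm z (n : ℂ),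
    show (n : ℂ) ^ z = n ^ (z - 1) * n by rw [cpow_sub _ _ hn0, cpow_one, div_mul_cancel₀ _ hn0]]
  field_simp

lemma Fstar_term_asymptotics {x₁ x₂ x₃ x₄ e f g : ℂ} (hs : e + f + g = x₁ + x₂ + x₃ + x₄ + 1)
    (h1 : NonInt x₁) (h2 : NonInt x₂) (h3 : NonInt x₃) (h4 : NonInt x₄)
    (he : NonInt e) (hf : NonInt f) (hg : NonInt g) :
    Filter.Tendsto (fun k : ℕ => (k : ℂ) ^ 2 * ((Gamma (k + x₁) * Gamma (k + x₂) *
      Gamma (k + x₃) * Gamma (k + x₄)) / ((k.factorial : ℂ) * Gamma (k + e) * Gamma (k + f) *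
      Gamma (k + g)))) Filter.atTop (nhds 1) := by
  have h := ((((tendsto_Gamma_add_nat h1).mul (tendsto_Gamma_add_nat h2)).mul
    (tendsto_Gamma_add_nat h3)).mul (tendsto_Gamma_add_nat h4)).div
    (((tendsto_Gamma_add_nat he).mul (tendsto_Gamma_add_nat hf)).mul
    (tendsto_Gamma_add_nat hg)) (by simp)
  simp only [mul_one, div_one] at h
  refine h.congr' ?_
  filter_upwards [Filter.eventually_gt_atTop 0] with n hn
  have hn0 : (n : ℂ) ≠ 0 := by exact_mod_cast hn.ne'
  have hp : ∀ z : ℂ, (n : ℂ) ^ z ≠ 0 := fun z => by simp [cpow_eq_zero_iff, hn0]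
  have hG : ∀ z : ℂ, NonInt z → Gamma (n + z) ≠ 0 := fun z hz =>
    NonInt.Gamma_ne_zero (hz.of_eq_add n (by push_cast; ring))
  have key : (n : ℂ) ^ (2 : ℕ) * ((n : ℂ) ^ (x₁ - 1) * (n : ℂ) ^ (x₂ - 1) * (n : ℂ) ^ (x₃ - 1) *
      (n : ℂ) ^ (x₄ - 1)) = (n : ℂ) ^ (e - 1) * (n : ℂ) ^ (f - 1) * (n : ℂ) ^ (g - 1) := by
    rw [← cpow_natCast]
    simp only [← cpow_add _ _ hn0]
    congr 1
    push_cast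
    linear_combination -hs
  have e1 := hG e he
  have f1 := hG f hf
  have g1 := hG g hg
  have q := factorial_ne n
  have p1 := hp (x₁ - 1)
  have p2 := hp (x₂ - 1)
  have p3 := hp (x₃ - 1)
  have p4 := hp (x₄ - 1)
  have p5 := hp (e - 1)
  have p6 := hp (f - 1)
  have p7 := hp (g - 1)
  clear hp hG h
  simp only [Pi.div_apply]
  generalize (n : ℂ) ^ (x₁ - 1) = a1 at *
  generalize (n : ℂ) ^ (x₂ - 1) = a2 at *
  generalize (n : ℂ) ^ (x₃ - 1) = a3 at *
  generalize (n : ℂ) ^ (x₄ - 1) = a4 at *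
  generalize (n : ℂ) ^ (e - 1) = a5 at *
  generalize (n : ℂ) ^ (f - 1) = a6 at *
  generalize (n : ℂ) ^ (g - 1) = a7 at *
  generalize Gamma (n + e) = b1 at *
  generalize Gamma (n + f) = b2 at *
  generalize Gamma (n + g) = b3 at *
  generalize (n.factorial : ℂ) = b4 at *
  field_simp
  linear_combination -(Gamma (n + x₁) * Gamma (n + x₂) * Gamma (n + x₃) * Gamma (n + x₄)) * key

lemma NonInt.Sn_ne_zero {e : ℂ} (he : NonInt e) : Sn e ≠ 0 := by
  rw [Sn]
  intro h
  obtain ⟨m, hm⟩ := Complex.sin_eq_zero_iff.1 h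
  exact he m (mul_left_cancel₀ (a := (Real.pi : ℂ)) (by simp [Real.pi_ne_zero])
    (by rw [hm]; ring))

lemma Gamma_mul_Sn {e : ℂ} (he : NonInt e) : Gamma e * Gamma (1 - e) * Sn e = Real.pi := by
  have h : Gamma e * Gamma (1 - e) = Real.pi / Sn e := Gamma_mul_Gamma_one_sub e
  rwa [eq_div_iff he.Sn_ne_zero] at h

lemma Gamma_two_sub {e : ℂ} (he : NonInt e) : Gamma (2 - e) * Gamma e * Sn e = (1 - e) * Real.pi := by
  have h0 : (1 : ℂ) - e ≠ 0 := (he.of_eq_sub 1 (by push_cast; ring)).ne_zero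
  rw [show 2 - e = 1 - e + 1 by ring, Gamma_add_one _ h0, ← Gamma_mul_Sn he]
  ring

/-- The function `Lf` is a limit of finite sums. -/
lemma tendsto_omegaSum {x₁ x₂ x₃ x₄ e f g : ℂ} (hs : e + f + g = x₁ + x₂ + x₃ + x₄ + 1)
    (h1 : NonInt x₁) (h2 : NonInt x₂) (h3 : NonInt x₃) (h4 : NonInt x₄)
    (he : NonInt e) (hf : NonInt f) (hg : NonInt g)
    (h1e : NonInt (x₁ - e)) (h2e : NonInt (x₂ - e)) (h3e : NonInt (x₃ - e)) (h4e : NonInt (x₄ - e))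
    (hfe : NonInt (f - e)) (hge : NonInt (g - e)) :
    Filter.Tendsto (fun N : ℕ => (N : ℂ) * omegaSum x₁ x₂ x₃ x₄ e f g N /
      (Real.pi * (Gamma f * Gamma g * Gamma (1 + f - e) * Gamma (1 + g - e)))) Filter.atTop
      (nhds (Lf x₁ x₂ x₃ x₄ e f g)) := by
  have k1 : NonInt (1 + x₁ - e) := h1e.of_eq_add 1 (by push_cast; ring)
  have k2 : NonInt (1 + x₂ - e) := h2e.of_eq_add 1 (by push_cast; ring)
  have k3 : NonInt (1 + x₃ - e) := h3e.of_eq_add 1 (by push_cast; ring)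
  have k4 : NonInt (1 + x₄ - e) := h4e.of_eq_add 1 (by push_cast; ring)
  have ke : NonInt (2 - e) := he.of_eq_sub 2 (by push_cast; ring)
  have kf : NonInt (1 + f - e) := hfe.of_eq_add 1 (by push_cast; ring)
  have kg : NonInt (1 + g - e) := hge.of_eq_add 1 (by push_cast; ring)
  have A := Fstar_term_asymptotics hs h1 h2 h3 h4 he hf hg
  have B := Fstar_term_asymptotics (x₁ := 1 + x₁ - e) (x₂ := 1 + x₂ - e) (x₃ := 1 + x₃ - e)
    (x₄ := 1 + x₄ - e) (e := 2 - e) (f := 1 + f - e) (g := 1 + g - e)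
    (by linear_combination hs) k1 k2 k3 k4 ke kf kg
  have h := (tendsto_antisymmetric_convolution (1 - e) A B).div_const
    (Sn e * Gamma x₁ * Gamma x₂ * Gamma x₃ * Gamma x₄ *
      Gamma (1 + x₁ - e) * Gamma (1 + x₂ - e) * Gamma (1 + x₃ - e) * Gamma (1 + x₄ - e))
  have hL : (∑' k : ℕ, (Gamma (k + x₁) * Gamma (k + x₂) * Gamma (k + x₃) * Gamma (k + x₄)) /
      ((k.factorial : ℂ) * Gamma (k + e) * Gamma (k + f) * Gamma (k + g)) -
      ∑' k : ℕ, (Gamma (k + (1 + x₁ - e)) * Gamma (k + (1 + x₂ - e)) * Gamma (k + (1 + x₃ - e)) *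
        Gamma (k + (1 + x₄ - e))) / ((k.factorial : ℂ) * Gamma (k + (2 - e)) *
        Gamma (k + (1 + f - e)) * Gamma (k + (1 + g - e)))) /
      (Sn e * Gamma x₁ * Gamma x₂ * Gamma x₃ * Gamma x₄ * Gamma (1 + x₁ - e) *
        Gamma (1 + x₂ - e) * Gamma (1 + x₃ - e) * Gamma (1 + x₄ - e)) =
      Lf x₁ x₂ x₃ x₄ e f g := rfl
  rw [hL] at h
  refine h.congr fun N => ?_
  rw [mul_div_assoc, mul_div_assoc, omegaSum, Finset.sum_div, Finset.sum_div]
  congr 1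
  refine Finset.sum_congr rfl fun p _ => ?_
  simp only [Gamma_add_nat h1, Gamma_add_nat h2, Gamma_add_nat h3, Gamma_add_nat h4,
    Gamma_add_nat he, Gamma_add_nat hf, Gamma_add_nat hg, Gamma_add_nat k1, Gamma_add_nat k2,
    Gamma_add_nat k3, Gamma_add_nat k4, Gamma_add_nat ke, Gamma_add_nat kf, Gamma_add_nat kg]
  have hpi : (Real.pi : ℂ) = Gamma (2 - e) * Gamma e * Sn e / (1 - e) := by
    rw [Gamma_two_sub he, mul_div_cancel_left₀]
    exact (he.of_eq_sub 1 (by push_cast; ring)).ne_zero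
  have n0 : 1 - e ≠ 0 := (he.of_eq_sub 1 (by push_cast; ring)).ne_zero
  rw [omegaTerm, hpi]
  have n1 := h1.Gamma_ne_zero
  have n2 := h2.Gamma_ne_zero
  have n3 := h3.Gamma_ne_zero
  have n4 := h4.Gamma_ne_zero
  have n5 := k1.Gamma_ne_zero
  have n6 := k2.Gamma_ne_zero
  have n7 := k3.Gamma_ne_zero
  have n8 := k4.Gamma_ne_zero
  have m1 := he.Gamma_ne_zero
  have m2 := hf.Gamma_ne_zero
  have m3 := hg.Gamma_ne_zero
  have m4 := ke.Gamma_ne_zero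
  have m5 := kf.Gamma_ne_zero
  have m6 := kg.Gamma_ne_zero
  have q1 := he.poch_ne_zero p.1
  have q2 := hf.poch_ne_zero p.1
  have q3 := hg.poch_ne_zero p.1
  have q4 := ke.poch_ne_zero p.2
  have q5 := kf.poch_ne_zero p.2
  have q6 := kg.poch_ne_zero p.2
  have f1 := factorial_ne p.1
  have f2 := factorial_ne p.2
  have s1 := he.Sn_ne_zero
  rw [show (p.2 : ℂ) - p.1 + (1 - e) = p.2 - p.1 + 1 - e by ring]
  clear h hL A B hpi k1 k2 k3 k4 ke kf kg h1e h2e h3e h4e hfe hge hs he hf hg h1 h2 h3 h4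
  generalize (p.2 : ℂ) - p.1 + 1 - e = A at *
  generalize (p.1.factorial : ℂ) = F1 at *
  generalize (p.2.factorial : ℂ) = F2 at *
  generalize Gamma x₁ = G1 at *
  generalize Gamma x₂ = G2 at *
  generalize Gamma x₃ = G3 at *
  generalize Gamma x₄ = G4 at *
  generalize Gamma (1 + x₁ - e) = G5 at *
  generalize Gamma (1 + x₂ - e) = G6 at *
  generalize Gamma (1 + x₃ - e) = G7 at *
  generalize Gamma (1 + x₄ - e) = G8 at *
  generalize Gamma (1 + f - e) = G9 at *
  generalize Gamma (1 + g - e) = G10 at *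
  generalize Gamma (2 - e) = G11 at *
  generalize Gamma e = G12 at *
  generalize Gamma f = G13 at *
  generalize Gamma g = G14 at *
  generalize poch e p.1 = P1 at *
  generalize poch f p.1 = P2 at *
  generalize poch g p.1 = P3 at *
  generalize poch (2 - e) p.2 = P4 at *
  generalize poch (1 + f - e) p.2 = P5 at *
  generalize poch (1 + g - e) p.2 = P6 at *
  generalize Sn e = S at *
  generalize 1 - e = E at *
  field_simp

lemma Lf_reverse (x₁ x₂ x₃ x₄ e f g : ℂ) : Lf x₄ x₃ x₂ x₁ e f g = Lf x₁ x₂ x₃ x₄ e f g := by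
  have h : ∀ y₁ y₂ y₃ y₄ a b c, Fstar y₄ y₃ y₂ y₁ a b c = Fstar y₁ y₂ y₃ y₄ a b c := by
    intro y₁ y₂ y₃ y₄ a b c
    unfold Fstar
    refine tsum_congr fun k => ?_
    congr 1
    ring
  rw [Lf, Lf, h x₁ x₂ x₃ x₄, h (1 + x₁ - e)]
  congr 1
  ring

/-- The two-term relation for `Lf`. -/
lemma Lf_two_term {x₁ x₂ x₃ x₄ e f g : ℂ} (hs : e + f + g = x₁ + x₂ + x₃ + x₄ + 1)
    (h1 : NonInt x₁) (h2 : NonInt x₂) (h3 : NonInt x₃) (h4 : NonInt x₄)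
    (he : NonInt e) (hf : NonInt f) (hg : NonInt g)
    (h1e : NonInt (x₁ - e)) (h2e : NonInt (x₂ - e)) (h3e : NonInt (x₃ - e)) (h4e : NonInt (x₄ - e))
    (h1f : NonInt (x₁ - f)) (h2f : NonInt (x₂ - f)) (h3f : NonInt (x₃ - f)) (h4f : NonInt (x₄ - f))
    (h1g : NonInt (x₁ - g)) (h2g : NonInt (x₂ - g)) (h3g : NonInt (x₃ - g)) (h4g : NonInt (x₄ - g))
    (hfe : NonInt (f - e)) (hge : NonInt (g - e)) (hfg : NonInt (f - g)) :
    Lf x₁ x₂ x₃ x₄ e f g =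
      Lf (f - x₁) (f - x₂) (f - x₃) (f - x₄) (1 + f - g) f (1 + f - e) := by
  rw [← Lf_reverse (f - x₁)]
  have A := tendsto_omegaSum hs h1 h2 h3 h4 he hf hg h1e h2e h3e h4e hfe hge
  have B := tendsto_omegaSum (x₁ := f - x₄) (x₂ := f - x₃) (x₃ := f - x₂) (x₄ := f - x₁)
    (e := 1 + f - g) (f := f) (g := 1 + f - e) (by linear_combination -hs)
    (h4f.of_eq_sub 0 (by push_cast; ring)) (h3f.of_eq_sub 0 (by push_cast; ring))
    (h2f.of_eq_sub 0 (by push_cast; ring)) (h1f.of_eq_sub 0 (by push_cast; ring))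
    (hfg.of_eq_add 1 (by push_cast; ring)) hf (hfe.of_eq_add 1 (by push_cast; ring))
    (h4g.of_eq_sub (-1) (by push_cast; ring)) (h3g.of_eq_sub (-1) (by push_cast; ring))
    (h2g.of_eq_sub (-1) (by push_cast; ring)) (h1g.of_eq_sub (-1) (by push_cast; ring))
    (hg.of_eq_add (-1) (by push_cast; ring)) (hge.of_eq_add 0 (by push_cast; ring))
  refine tendsto_nhds_unique A (B.congr fun N => ?_)
  rw [omegaSum_transform x₁ x₂ x₃ x₄ e f g hs he hf hg h2e h4e h2g h4g hfe hge hfg N,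
    show 1 + f - (1 + f - g) = g by ring, show 1 + (1 + f - e) - (1 + f - g) = 1 + g - e by ring]
  congr 2
  ring

/-- Partial fractions for a rational function with four arithmetic progressions of poles. -/
lemma sum_residues_eq_zero (x y : Fin 4 → ℂ) (n : ℕ) (N : Fin 4 → ℕ)
    (hx : ∀ i j, i ≠ j → NonInt (x i - x j)) (hN : ∑ i, N i + 2 ≤ 4 * n) :
    ∑ i, ∑ k ∈ Finset.range n, (∏ j, poch (y j - x i - k) (N j)) /
      ((-1) ^ k * k.factorial * (n - 1 - k).factorial *
        ∏ j ∈ Finset.univ.erase i, poch (x j - x i - k) n) = 0 := by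
  classical
  set s : Finset (Fin 4 × ℕ) := Finset.univ ×ˢ Finset.range n with hs
  have hcard : s.card = 4 * n := by simp [hs]
  let v : Fin 4 × ℕ → ℂ := fun p => -x p.1 - p.2
  have hv : Set.InjOn v s := by
    rintro ⟨i, k⟩ - ⟨j, l⟩ - h
    have h' : x i - x j = ((l - k : ℤ) : ℂ) := by
      push_cast
      have : -x i - (k : ℂ) = -x j - l := h
      linear_combination -this
    by_cases hij : i = j
    · subst hij
      have : ((l - k : ℤ) : ℂ) = 0 := by rw [← h']; ring
      have : (l - k : ℤ) = 0 := by exact_mod_cast this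
      rw [Prod.mk.injEq]
      exact ⟨rfl, by omega⟩
    · exact absurd h' (hx i j hij _)
  let P : Polynomial ℂ := ∏ j, ∏ l ∈ Finset.range (N j),
    (Polynomial.X + Polynomial.C (y j + l))
  have hP : P.natDegree ≤ ∑ i, N i := by
    refine (Polynomial.natDegree_prod_le _ _).trans (Finset.sum_le_sum fun j _ => ?_)
    refine (Polynomial.natDegree_prod_le _ _).trans ?_
    simp only [Polynomial.natDegree_X_add_C, Finset.sum_const, Finset.card_range, smul_eq_mul,
      mul_one, le_refl]
  have hP' : P.degree < s.card := by
    refine Polynomial.degree_le_natDegree.trans_lt ?_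
    rw [hcard]
    exact_mod_cast (by omega : P.natDegree < 4 * n)
  have key := Lagrange.coeff_eq_sum hv hP'
  rw [Polynomial.coeff_eq_zero_of_natDegree_lt (by omega), hs, Finset.sum_product] at key
  rw [key]
  refine Finset.sum_congr rfl fun i _ => Finset.sum_congr rfl fun k hk => ?_
  have hk' : k < n := by simpa using hk
  have hev : P.eval (v (i, k)) = ∏ j, poch (y j - x i - k) (N j) := by
    simp only [P, v, poch, Polynomial.eval_prod, Polynomial.eval_add, Polynomial.eval_X,
      Polynomial.eval_C]
    refine Finset.prod_congr rfl fun j _ => Finset.prod_congr rfl fun l _ => ?_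
    ring
  have hsplit : (Finset.univ ×ˢ Finset.range n).erase (i, k) =
      ({i} ×ˢ (Finset.range n).erase k) ∪ ((Finset.univ.erase i) ×ˢ Finset.range n) := by
    ext ⟨j, l⟩
    simp only [Finset.mem_erase, Finset.mem_product, Finset.mem_union, Finset.mem_singleton,
      Finset.mem_univ, Finset.mem_range, ne_eq, Prod.mk.injEq]
    by_cases h : j = i <;> by_cases h' : l = k <;> simp_all
  have hdisj : Disjoint ({i} ×ˢ (Finset.range n).erase k)
      ((Finset.univ.erase i) ×ˢ Finset.range n) := by
    rw [Finset.disjoint_left]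
    rintro ⟨j, l⟩ h h'
    simp only [Finset.mem_erase, Finset.mem_product, Finset.mem_singleton] at h h'
    exact h'.1.1 h.1
  have hrow : ∏ l ∈ (Finset.range n).erase k, ((l : ℂ) - k) =
      (-1) ^ k * k.factorial * (n - 1 - k).factorial := by
    obtain ⟨m, rfl⟩ : ∃ m, n = k + (m + 1) := ⟨n - 1 - k, by omega⟩
    have : (Finset.range (k + (m + 1))).erase k =
        Finset.range k ∪ (Finset.range m).map (addLeftEmbedding (k + 1)) := by
      ext l
      simp only [Finset.mem_erase, Finset.mem_union, Finset.mem_range, Finset.mem_map,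
        addLeftEmbedding_apply]
      constructor
      · rintro ⟨h1, h2⟩
        by_cases h : l < k
        · exact Or.inl h
        · exact Or.inr ⟨l - (k + 1), by omega, by omega⟩
      · rintro (h | ⟨l, h1, rfl⟩) <;> omega
    rw [this, Finset.prod_union, Finset.prod_map]
    · have e1 : ∏ l ∈ Finset.range k, ((l : ℂ) - k) = (-1) ^ k * k.factorial := by
        rw [← Finset.prod_range_reflect, ← Finset.prod_range_add_one_eq_factorial]
        push_cast
        have e0 : ((-1 : ℂ)) ^ k = ∏ _l ∈ Finset.range k, (-1 : ℂ) := by simp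
        rw [e0, ← Finset.prod_mul_distrib]
        refine Finset.prod_congr rfl fun l hl => ?_
        have : l < k := by simpa using hl
        rw [Nat.cast_sub (by omega), Nat.cast_sub (by omega)]
        push_cast
        ring
      have e2 : ∏ l ∈ Finset.range m, (((addLeftEmbedding (k + 1) l : ℕ) : ℂ) - k) =
          m.factorial := by
        rw [← Finset.prod_range_add_one_eq_factorial]
        push_cast
        refine Finset.prod_congr rfl fun l _ => ?_
        rw [addLeftEmbedding_apply]
        push_cast
        ring
      rw [e1, e2, show k + (m + 1) - 1 - k = m by omega]
    · rw [Finset.disjoint_left]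
      intro l h h'
      simp only [Finset.mem_map, Finset.mem_range, addLeftEmbedding_apply] at h h'
      omega
  rw [hev, hsplit, Finset.prod_union hdisj, Finset.prod_product, Finset.prod_product,
    Finset.prod_singleton]
  congr 2
  · rw [← hrow]
    refine Finset.prod_congr rfl fun l _ => ?_
    simp only [v]
    ring
  · refine Finset.prod_congr rfl fun j _ => Finset.prod_congr rfl fun l _ => ?_
    simp only [v]
    ring

lemma tendsto_cpow_ratio (r : ℂ) (k : ℕ) :
    Filter.Tendsto (fun n : ℕ => ((n - k : ℕ) : ℂ) ^ r / ((n + k : ℕ) : ℂ) ^ r) Filter.atTop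
      (nhds 1) := by
  have h1 : Filter.Tendsto (fun n : ℕ => 1 - 2 * (k : ℝ) / ((n + k : ℕ) : ℝ)) Filter.atTop
      (nhds (1 - 0)) :=
    tendsto_const_nhds.sub ((tendsto_const_nhds (x := 2 * (k : ℝ))).div_atTop
      (tendsto_natCast_atTop_atTop.comp (Filter.tendsto_add_atTop_nat k)))
  rw [sub_zero] at h1
  have h2 : Filter.Tendsto (fun n : ℕ => ((1 - 2 * (k : ℝ) / ((n + k : ℕ) : ℝ) : ℝ) : ℂ) ^ r)
      Filter.atTop (nhds ((1 : ℂ) ^ r)) := by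
    refine Filter.Tendsto.cpow ?_ tendsto_const_nhds (by simp)
    exact (Complex.continuous_ofReal.tendsto 1).comp h1
  rw [one_cpow] at h2
  refine h2.congr' ?_
  filter_upwards [Filter.eventually_gt_atTop k] with n hn
  have hn0 : ((n + k : ℕ) : ℂ) ≠ 0 := by exact_mod_cast (by omega : n + k ≠ 0)
  have hr : ((n + k : ℕ) : ℝ) ≠ 0 := by exact_mod_cast (by omega : n + k ≠ 0)
  have hq : 1 - 2 * (k : ℝ) / ((n + k : ℕ) : ℝ) = ((n - k : ℕ) : ℝ) / ((n + k : ℕ) : ℝ) := by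
    rw [eq_div_iff hr, sub_mul, div_mul_cancel₀ _ hr, Nat.cast_sub hn.le]
    push_cast
    ring
  rw [eq_div_iff (by rw [ne_eq, cpow_eq_zero_iff]; exact fun h => hn0 h.1), hq, ← ofReal_natCast (n + k),
    ← Complex.mul_cpow_ofReal_nonneg (by positivity) (by positivity), ← ofReal_mul,
    div_mul_cancel₀ _ hr, ofReal_natCast]

lemma summable_norm_mul_rpow_of_tendsto_sq_mul {u : ℕ → ℂ} {L : ℂ}
    (hu : Filter.Tendsto (fun k : ℕ => (k : ℂ) ^ 2 * u k) Filter.atTop (nhds L)) :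
    Summable fun k : ℕ => ‖u k‖ * (2 * (k : ℝ) + 1) ^ (1 / 2 : ℝ) := by
  obtain ⟨C, hC⟩ := (Metric.isBounded_range_of_tendsto _ hu).exists_norm_le
  have hC' : ∀ k : ℕ, ‖(k : ℂ) ^ 2 * u k‖ ≤ C := fun k => hC _ ⟨k, rfl⟩
  rw [← summable_nat_add_iff 1]
  refine Summable.of_nonneg_of_le (fun k => by positivity) (fun k => ?_)
    (((summable_nat_add_iff 1).2
      (Real.summable_nat_rpow_inv.2 (by norm_num : (1 : ℝ) < 3 / 2))).mul_left (C * 2))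
  have hk := hC' (k + 1)
  have h0 : (0 : ℝ) < ((k + 1 : ℕ) : ℝ) := by positivity
  set m : ℝ := ((k + 1 : ℕ) : ℝ) with hm
  have h1 : (1 : ℝ) ≤ m := by rw [hm]; push_cast; linarith [(Nat.cast_nonneg k : (0 : ℝ) ≤ k)]
  rw [norm_mul, norm_pow, Complex.norm_natCast, ← hm] at hk
  have h2 : (2 * m + 1) ^ (1 / 2 : ℝ) ≤ 2 * m ^ (1 / 2 : ℝ) := by
    calc (2 * m + 1) ^ (1 / 2 : ℝ) ≤ (4 * m) ^ (1 / 2 : ℝ) :=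
          Real.rpow_le_rpow (by positivity) (by linarith) (by norm_num)
      _ = 2 * m ^ (1 / 2 : ℝ) := by
          rw [Real.mul_rpow (by norm_num) h0.le, ← Real.sqrt_eq_rpow 4,
            show (4 : ℝ) = 2 ^ 2 by norm_num, Real.sqrt_sq (by norm_num)]
  have h3 : (m ^ (3 / 2 : ℝ))⁻¹ = m ^ (1 / 2 : ℝ) * (m ^ 2)⁻¹ := by
    rw [← Real.rpow_neg h0.le, ← Real.rpow_natCast, ← Real.rpow_neg h0.le, ← Real.rpow_add h0]
    norm_num
  calc ‖u (k + 1)‖ * (2 * m + 1) ^ (1 / 2 : ℝ) ≤ (C / m ^ 2) * (2 * m ^ (1 / 2 : ℝ)) := by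
        refine mul_le_mul ?_ h2 (by positivity) ?_
        · rw [le_div_iff₀ (by positivity)]
          linarith
        · exact div_nonneg ((norm_nonneg _).trans (hC' 0)) (by positivity)
    _ = C * 2 * (m ^ (3 / 2 : ℝ))⁻¹ := by
        rw [h3]
        ring

/-- A form of dominated convergence for sums with slowly varying weights. -/
lemma tendsto_weighted_sum {u X Y : ℕ → ℂ} {r L : ℂ} (hr : |r.re| ≤ 1 / 2)
    (hu : Filter.Tendsto (fun k : ℕ => (k : ℂ) ^ 2 * u k) Filter.atTop (nhds L))
    (hX : Filter.Tendsto (fun n : ℕ => X n / (n : ℂ) ^ r) Filter.atTop (nhds 1))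
    (hY : Filter.Tendsto (fun n : ℕ => Y n * (n : ℂ) ^ r) Filter.atTop (nhds 1)) :
    Filter.Tendsto (fun n : ℕ => ∑ k ∈ Finset.range n, u k * (X (n - k) * Y (n + k)))
      Filter.atTop (nhds (∑' k, u k)) := by
  obtain ⟨C, hC⟩ := (Metric.isBounded_range_of_tendsto _ hX).exists_norm_le
  obtain ⟨D, hD⟩ := (Metric.isBounded_range_of_tendsto _ hY).exists_norm_le
  have hC' : ∀ n : ℕ, ‖X n / (n : ℂ) ^ r‖ ≤ C := fun n => hC _ ⟨n, rfl⟩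
  have hD' : ∀ n : ℕ, ‖Y n * (n : ℂ) ^ r‖ ≤ D := fun n => hD _ ⟨n, rfl⟩
  have hC0 : 0 ≤ C := (norm_nonneg _).trans (hC' 0)
  have hD0 : 0 ≤ D := (norm_nonneg _).trans (hD' 0)
  have hdecomp : ∀ n k : ℕ, k < n → X (n - k) * Y (n + k) =
      (X (n - k) / ((n - k : ℕ) : ℂ) ^ r) * (Y (n + k) * ((n + k : ℕ) : ℂ) ^ r) *
        (((n - k : ℕ) : ℂ) ^ r / ((n + k : ℕ) : ℂ) ^ r) := by
    intro n k h
    have a1 : ((n - k : ℕ) : ℂ) ^ r ≠ 0 := by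
      rw [ne_eq, cpow_eq_zero_iff, Nat.cast_eq_zero]
      omega
    have a2 : ((n + k : ℕ) : ℂ) ^ r ≠ 0 := by
      rw [ne_eq, cpow_eq_zero_iff, Nat.cast_eq_zero]
      omega
    field_simp
  have hratio : ∀ n k : ℕ, k < n → ‖((n - k : ℕ) : ℂ) ^ r / ((n + k : ℕ) : ℂ) ^ r‖ ≤
      (2 * (k : ℝ) + 1) ^ (1 / 2 : ℝ) := by
    intro n k h
    have p1 : (1 : ℝ) ≤ ((n - k : ℕ) : ℝ) := by exact_mod_cast (by omega : 1 ≤ n - k)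
    have p2 : ((n + k : ℕ) : ℝ) = ((n - k : ℕ) : ℝ) + 2 * k := by
      rw [Nat.cast_sub h.le]
      push_cast
      ring
    rw [norm_div, norm_natCast_cpow_of_pos (by omega), norm_natCast_cpow_of_pos (by omega),
      p2]
    generalize ((n - k : ℕ) : ℝ) = m at *
    have k0 : (0 : ℝ) ≤ k := Nat.cast_nonneg k
    have m0 : 0 < m := by linarith
    rw [← Real.div_rpow m0.le (by linarith)]
    have q0 : 0 < m / (m + 2 * k) := by positivity
    have q1 : m / (m + 2 * k) ≤ 1 := by
      rw [div_le_one (by linarith)]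
      linarith
    calc (m / (m + 2 * k)) ^ r.re ≤ (m / (m + 2 * k)) ^ (-(1 / 2) : ℝ) :=
          Real.rpow_le_rpow_of_exponent_ge q0 q1 (by linarith [(abs_le.1 hr).1])
      _ = ((m + 2 * k) / m) ^ (1 / 2 : ℝ) := by
          rw [Real.rpow_neg q0.le, ← Real.inv_rpow q0.le, inv_div]
      _ ≤ (2 * (k : ℝ) + 1) ^ (1 / 2 : ℝ) := by
          refine Real.rpow_le_rpow (by positivity) ?_ (by norm_num)
          rw [div_le_iff₀ m0]
          nlinarith
  have h : Filter.Tendsto (fun n => ∑' k, if k < n then u k * (X (n - k) * Y (n + k)) else 0)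
      Filter.atTop (nhds (∑' k, u k)) := by
    refine tendsto_tsum_of_dominated_convergence
      ((summable_norm_mul_rpow_of_tendsto_sq_mul hu).mul_right (C * D)) (fun k => ?_)
      (Filter.Eventually.of_forall fun n k => ?_)
    · have h1 := ((hX.comp (Filter.tendsto_sub_atTop_nat k)).mul
        (hY.comp (Filter.tendsto_add_atTop_nat k))).mul (tendsto_cpow_ratio r k)
      have h2 := h1.const_mul (u k)
      simp only [mul_one] at h2
      refine h2.congr' ?_
      filter_upwards [Filter.eventually_gt_atTop k] with n hn
      rw [if_pos hn, hdecomp n k hn]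
      rfl
    · split_ifs with hkn
      · have h1 := mul_le_mul (hC' (n - k)) (hD' (n + k)) (norm_nonneg _) hC0
        have h2 := mul_le_mul h1 (hratio n k hkn) (norm_nonneg _) (by positivity)
        calc ‖u k * (X (n - k) * Y (n + k))‖ ≤
              ‖u k‖ * (C * D * (2 * (k : ℝ) + 1) ^ (1 / 2 : ℝ)) := by
              rw [hdecomp n k hkn, norm_mul, norm_mul, norm_mul (X (n - k) / _)]
              exact mul_le_mul_of_nonneg_left h2 (norm_nonneg _)
          _ = _ := by ring
      · rw [norm_zero]
        positivity
  refine h.congr fun n => ?_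
  rw [tsum_eq_sum (s := Finset.range n) (fun k hk => if_neg (by simpa using hk))]
  exact Finset.sum_congr rfl fun k hk => if_pos (by simpa using hk)

/-- The ratio `Γ(n + z) / Γ(n + w)`. -/
def gammaRatio (z w : ℂ) (n : ℕ) : ℂ := Gamma (n + z) / Gamma (n + w)

lemma tendsto_Gamma_natCast :
    Filter.Tendsto (fun n : ℕ => Gamma (n + 0) / (n.factorial * (n : ℂ) ^ ((0 : ℂ) - 1)))
      Filter.atTop (nhds 1) := by
  refine tendsto_const_nhds.congr' ?_
  filter_upwards [Filter.eventually_gt_atTop 0] with n hn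
  obtain ⟨m, rfl⟩ : ∃ m, n = m + 1 := ⟨n - 1, by omega⟩
  have h : ((m + 1 : ℕ) : ℂ) ≠ 0 := by exact_mod_cast hn.ne'
  have hm := factorial_ne m
  rw [add_zero, zero_sub, cpow_neg_one, Nat.factorial_succ, Nat.cast_mul]
  push_cast at h ⊢
  rw [Gamma_nat_eq_factorial]
  field_simp

lemma tendsto_gammaRatio {z w : ℂ}
    (hz : Filter.Tendsto (fun n : ℕ => Gamma (n + z) / (n.factorial * (n : ℂ) ^ (z - 1)))
      Filter.atTop (nhds 1))
    (hw : Filter.Tendsto (fun n : ℕ => Gamma (n + w) / (n.factorial * (n : ℂ) ^ (w - 1)))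
      Filter.atTop (nhds 1)) :
    Filter.Tendsto (fun n : ℕ => gammaRatio z w n / (n : ℂ) ^ (z - w)) Filter.atTop (nhds 1) := by
  have h := hz.div hw one_ne_zero
  rw [div_one] at h
  refine h.congr' ?_
  filter_upwards [Filter.eventually_gt_atTop 0] with n hn
  have hn0 : (n : ℂ) ≠ 0 := by exact_mod_cast hn.ne'
  have h1 : (n : ℂ) ^ (w - 1) ≠ 0 := by simp [cpow_eq_zero_iff, hn0]
  have h2 : (n : ℂ) ^ (z - w) ≠ 0 := by simp [cpow_eq_zero_iff, hn0]
  have hn' := factorial_ne n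
  simp only [Pi.div_apply]
  rw [gammaRatio, show z - 1 = (z - w) + (w - 1) by ring, cpow_add _ _ hn0, div_div_div_eq,
    div_div]
  rw [show Gamma (n + z) * ((n.factorial : ℂ) * (n : ℂ) ^ (w - 1)) =
    ((n.factorial : ℂ) * (n : ℂ) ^ (w - 1)) * Gamma (n + z) by ring,
    show (n.factorial : ℂ) * ((n : ℂ) ^ (z - w) * (n : ℂ) ^ (w - 1)) * Gamma (n + w) =
    ((n.factorial : ℂ) * (n : ℂ) ^ (w - 1)) * (Gamma (n + w) * (n : ℂ) ^ (z - w)) by ring,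
    mul_div_mul_left _ _ (mul_ne_zero hn' h1)]

lemma Filter.Tendsto.cpow_mul {X Y : ℕ → ℂ} {r s t : ℂ} (ht : t = r + s)
    (hX : Filter.Tendsto (fun n : ℕ => X n / (n : ℂ) ^ r) Filter.atTop (nhds 1))
    (hY : Filter.Tendsto (fun n : ℕ => Y n / (n : ℂ) ^ s) Filter.atTop (nhds 1)) :
    Filter.Tendsto (fun n : ℕ => X n * Y n / (n : ℂ) ^ t) Filter.atTop (nhds 1) := by
  have h := hX.mul hY
  rw [mul_one] at h
  refine h.congr' ?_
  filter_upwards [Filter.eventually_gt_atTop 0] with n hn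
  have hn0 : (n : ℂ) ≠ 0 := by exact_mod_cast hn.ne'
  rw [ht, cpow_add _ _ hn0, mul_div_mul_comm]

lemma Sn_add_one (z : ℂ) : Sn (z + 1) = -Sn z := by
  rw [Sn, Sn, mul_add, mul_one, Complex.sin_add_pi]

lemma Sn_add_nat (z : ℂ) (k : ℕ) : Sn (z + k) = (-1) ^ k * Sn z := by
  induction k with
  | zero => simp
  | succ k ih =>
    rw [Nat.cast_succ, ← add_assoc, Sn_add_one, ih]
    ring

lemma Sn_neg (z : ℂ) : Sn (-z) = -Sn z := by
  rw [Sn, Sn, mul_neg, Complex.sin_neg]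

lemma Sn_sub_nat (z : ℂ) (k : ℕ) : Sn (z - k) = (-1) ^ k * Sn z := by
  rw [show z - k = -(-z + k) by ring, Sn_neg, Sn_add_nat, Sn_neg]
  ring

lemma poch_eq_Gamma_div {z : ℂ} (hz : NonInt z) (n : ℕ) : poch z n = Gamma (n + z) / Gamma z := by
  rw [Gamma_add_nat hz, mul_div_cancel_left₀ _ hz.Gamma_ne_zero]

lemma poch_sub_nat {z : ℂ} (hz : NonInt z) (k N : ℕ) :
    poch (z - k) N = (-1) ^ k * (Gamma (N + (z - k)) * Gamma (k + (1 - z)) * Sn z / Real.pi) := by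
  have h : NonInt (z - k) := hz.of_eq_add (-k) (by push_cast; ring)
  rw [poch_eq_Gamma_div h, ← Gamma_mul_Sn h, Sn_sub_nat,
    show 1 - (z - k) = k + (1 - z) by ring]
  have h1 := h.Gamma_ne_zero
  have h2 := NonInt.Gamma_ne_zero (hz.of_eq_sub (k + 1) (by push_cast; ring) :
    NonInt (k + (1 - z)))
  have h3 := hz.Sn_ne_zero
  have h4 : (-1 : ℂ) ^ k ≠ 0 := by simp
  field_simp

lemma poch_sub_self_sub {z : ℂ} (hz : NonInt z) (N : ℕ) :
    poch (1 - N - z) N = (-1) ^ N * (Gamma (N + z) / Gamma z) := by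
  rw [← poch_eq_Gamma_div hz, ← poch_reflect]
  congr 1
  ring

lemma residue_term_first {a b c d e f g : ℂ} {M : ℤ} {n nd ng k : ℕ} (hk : k < n)
    (hnd : (nd : ℤ) = n + M) (hng : (ng : ℤ) = n - 2 - M)
    (ha : NonInt a) (hb : NonInt b) (hc : NonInt c) (hd : NonInt d)
    (he : NonInt e) (hf : NonInt f) (hg : NonInt g) :
    poch (e + k) n * poch (f + k) n * poch (g + k) ng * poch (d - nd + k) nd /
      ((-1) ^ (n - 1 - k) * (n - 1 - k).factorial * k.factorial *
        (poch (a + k) n * poch (b + k) n * poch (c + k) n)) =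
      -(-1) ^ (n + nd) * (Sn d / Real.pi) * ((Gamma (k + a) * Gamma (k + b) * Gamma (k + c) *
        Gamma (k + d)) / ((k.factorial : ℂ) * Gamma (k + e) * Gamma (k + f) * Gamma (k + g)) *
        (gammaRatio (M + 1 - d) 0 (n - k) * (gammaRatio e a (n + k) * gammaRatio f b (n + k) *
          gammaRatio (g - 2 - M) c (n + k)))) := by
  have hz : ∀ {z : ℂ}, NonInt z → NonInt (k + z) := fun hz =>
    hz.of_eq_add k (by push_cast; ring)
  have hG : ∀ {z : ℂ}, NonInt z → ∀ N : ℕ, poch (z + k) N = Gamma (N + (k + z)) / Gamma (k + z) :=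
    fun {z} h N => by rw [add_comm z, poch_eq_Gamma_div (hz h)]
  have h1d : NonInt (1 - d - k) := hd.of_eq_sub (1 - k) (by push_cast; ring)
  have hdk : poch (d - nd + k) nd = (-1) ^ nd * (Gamma (nd + (1 - d - k)) *
      (Gamma (k + d) * ((-1) ^ k * Sn d)) / Real.pi) := by
    rw [show d - nd + k = 1 - nd - (1 - d - k) by ring, poch_sub_self_sub h1d,
      ← Gamma_mul_Sn (hz hd), show 1 - (k + d) = 1 - d - k by ring, add_comm (k : ℂ) d,
      Sn_add_nat]
    have h1 := h1d.Gamma_ne_zero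
    have h2 : Gamma (d + k) ≠ 0 := NonInt.Gamma_ne_zero (hd.of_eq_add k (by push_cast; ring))
    have h3 := hd.Sn_ne_zero
    have h4 : (-1 : ℂ) ^ k ≠ 0 := by simp
    field_simp
  obtain ⟨m, rfl⟩ : ∃ m, n = k + 1 + m := ⟨n - 1 - k, by omega⟩
  have hndc : (nd : ℂ) = ((k + 1 + m : ℕ) : ℂ) + M := by exact_mod_cast congrArg (Int.cast : ℤ → ℂ) hnd
  have hngc : (ng : ℂ) = ((k + 1 + m : ℕ) : ℂ) - 2 - M := by
    have := congrArg (Int.cast : ℤ → ℂ) hng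
    push_cast at this ⊢
    exact this
  have hfac : Gamma (((k + 1 + m - k : ℕ) : ℂ) + 0) = m.factorial := by
    rw [show k + 1 + m - k = m + 1 by omega, add_zero, Nat.cast_succ, Gamma_nat_eq_factorial]
  rw [hG he, hG hf, hG hg, hG ha, hG hb, hG hc, hdk, gammaRatio, gammaRatio, gammaRatio,
    gammaRatio, hfac, show k + 1 + m - 1 - k = m by omega, show k + 1 + m - k = m + 1 by omega]
  have c1 : ∀ z : ℂ, ((k + 1 + m : ℕ) : ℂ) + (k + z) = ((k + 1 + m + k : ℕ) : ℂ) + z := by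
    intro z; push_cast; ring
  have c2 : (ng : ℂ) + (k + g) = ((k + 1 + m + k : ℕ) : ℂ) + (g - 2 - M) := by
    rw [hngc]; push_cast; ring
  have c3 : (nd : ℂ) + (1 - d - k) = ((m + 1 : ℕ) : ℂ) + (M + 1 - d) := by
    rw [hndc]; push_cast; ring
  rw [c1, c1, c1, c1, c1, c2, c3]
  have hw : ∀ {z : ℂ}, NonInt z → Gamma (((k + 1 + m + k : ℕ) : ℂ) + z) ≠ 0 := fun {z} h =>
    NonInt.Gamma_ne_zero (h.of_eq_add ((k + 1 + m + k : ℕ) : ℤ) (by push_cast; ring))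
  have a1 := hw ha
  have a2 := hw hb
  have a3 := hw hc
  have b1 := (hz ha).Gamma_ne_zero
  have b2 := (hz hb).Gamma_ne_zero
  have b3 := (hz hc).Gamma_ne_zero
  have b4 := (hz he).Gamma_ne_zero
  have b5 := (hz hf).Gamma_ne_zero
  have b6 := (hz hg).Gamma_ne_zero
  have f1 := factorial_ne k
  have f2 := factorial_ne m
  have p0 : (Real.pi : ℂ) ≠ 0 := by simp [Real.pi_ne_zero]
  have hsgn : -(-1 : ℂ) ^ (k + 1 + m + nd) = (-1) ^ nd * (-1) ^ k * (-1) ^ m := by ring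
  have hm : (-1 : ℂ) ^ m * (-1) ^ m = 1 := by rw [← mul_pow]; simp
  have hm0 : (-1 : ℂ) ^ m ≠ 0 := by simp
  rw [hsgn]
  clear hsgn c1 c2 c3 hw hz hG hdk hfac hndc hngc hnd hng hk h1d ha hb hc hd he hf hg
  generalize Gamma (((k + 1 + m + k : ℕ) : ℂ) + a) = A1 at *
  generalize Gamma (((k + 1 + m + k : ℕ) : ℂ) + b) = A2 at *
  generalize Gamma (((k + 1 + m + k : ℕ) : ℂ) + c) = A3 at *
  generalize Gamma (((k + 1 + m + k : ℕ) : ℂ) + e) = A4 at *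
  generalize Gamma (((k + 1 + m + k : ℕ) : ℂ) + f) = A5 at *
  generalize Gamma (((k + 1 + m + k : ℕ) : ℂ) + (g - 2 - M)) = A6 at *
  generalize Gamma (((m + 1 : ℕ) : ℂ) + (M + 1 - d)) = A7 at *
  generalize Gamma (k + a) = B1 at *
  generalize Gamma (k + b) = B2 at *
  generalize Gamma (k + c) = B3 at *
  generalize Gamma (k + d) = B4 at *
  generalize Gamma (k + e) = B5 at *
  generalize Gamma (k + f) = B6 at *
  generalize Gamma (k + g) = B7 at *
  generalize (k.factorial : ℂ) = F1 at *
  generalize (m.factorial : ℂ) = F2 at *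
  generalize (-1 : ℂ) ^ nd = s1 at *
  generalize (-1 : ℂ) ^ k = s2 at *
  generalize (-1 : ℂ) ^ m = s3 at *
  generalize Sn d = S at *
  generalize (Real.pi : ℂ) = p at *
  field_simp
  linear_combination -(A4 * A5 * A6 * s1 * A7 * B4 * s2 * S) * hm

set_option maxHeartbeats 1000000 in
lemma residue_term {a b c d e f g : ℂ} {M : ℤ} {n nd ng k : ℕ} (hk : k < n)
    (hnd : (nd : ℤ) = n + M) (hng : (ng : ℤ) = n - 2 - M)
    (ha : NonInt a) (hba : NonInt (b - a)) (hca : NonInt (c - a)) (hda : NonInt (d - a))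
    (hea : NonInt (e - a)) (hfa : NonInt (f - a)) (hga : NonInt (g - a)) :
    poch (e - a - k) n * poch (f - a - k) n * poch (g - a - k) ng * poch (d - nd - a - k) nd /
      ((-1) ^ k * k.factorial * (n - 1 - k).factorial *
        (poch (1 - n - a - k) n * poch (b - a - k) n * poch (c - a - k) n)) =
      (-1) ^ (n + nd) * (Sn (e - a) * Sn (f - a) * Sn (g - a) /
        (Real.pi * Sn (b - a) * Sn (c - a))) *
        ((Gamma (k + a) * Gamma (k + (1 + a - e)) * Gamma (k + (1 + a - f)) *
        Gamma (k + (1 + a - g))) / ((k.factorial : ℂ) * Gamma (k + (1 + a - b)) *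
        Gamma (k + (1 + a - c)) * Gamma (k + (1 + a - d))) *
        (gammaRatio (e - a) (b - a) (n - k) * gammaRatio (f - a) (c - a) (n - k) *
          gammaRatio (g - a - 2 - M) 0 (n - k) * gammaRatio (M + 1 + a - d) a (n + k))) := by
  have h1d : NonInt (k + (1 + a - d)) := hda.of_eq_sub (k + 1) (by push_cast; ring)
  have hka : NonInt (k + a) := ha.of_eq_add k (by push_cast; ring)
  obtain ⟨m, rfl⟩ : ∃ m, n = k + 1 + m := ⟨n - 1 - k, by omega⟩
  have hndc : (nd : ℂ) = ((k + 1 + m : ℕ) : ℂ) + M := by exact_mod_cast congrArg (Int.cast : ℤ → ℂ) hnd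
  have hngc : (ng : ℂ) = ((k + 1 + m : ℕ) : ℂ) - 2 - M := by
    have := congrArg (Int.cast : ℤ → ℂ) hng
    push_cast at this ⊢
    exact this
  have hfac : Gamma (((m + 1 : ℕ) : ℂ) + 0) = m.factorial := by
    rw [add_zero, Nat.cast_succ, Gamma_nat_eq_factorial]
  rw [poch_sub_nat hea, poch_sub_nat hfa, poch_sub_nat hga, poch_sub_nat hba, poch_sub_nat hca,
    show d - nd - a - k = 1 - nd - (k + (1 + a - d)) by ring, poch_sub_self_sub h1d,
    show (1 : ℂ) - ((k + 1 + m : ℕ) : ℂ) - a - k = 1 - ((k + 1 + m : ℕ) : ℂ) - (k + a) by ring,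
    poch_sub_self_sub hka, gammaRatio, gammaRatio, gammaRatio, gammaRatio,
    show k + 1 + m - 1 - k = m by omega, show k + 1 + m - k = m + 1 by omega, hfac]
  have c1 : ∀ z : ℂ, ((k + 1 + m : ℕ) : ℂ) + (z - k) = ((m + 1 : ℕ) : ℂ) + z := by
    intro z; push_cast; ring
  have c2 : (ng : ℂ) + (g - a - k) = ((m + 1 : ℕ) : ℂ) + (g - a - 2 - M) := by
    rw [hngc]; push_cast; ring
  have c3 : (nd : ℂ) + (k + (1 + a - d)) = ((k + 1 + m + k : ℕ) : ℂ) + (M + 1 + a - d) := by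
    rw [hndc]; push_cast; ring
  have c4 : ((k + 1 + m : ℕ) : ℂ) + (k + a) = ((k + 1 + m + k : ℕ) : ℂ) + a := by
    push_cast; ring
  have c5 : ∀ z : ℂ, 1 - (z - a) = 1 + a - z := fun z => by ring
  rw [c1, c1, c1, c1, c2, c3, c4, c5, c5, c5, c5, c5]
  have hw : ∀ {z : ℂ}, NonInt z → Gamma (((m + 1 : ℕ) : ℂ) + z) ≠ 0 := fun {z} h =>
    NonInt.Gamma_ne_zero (h.of_eq_add ((m + 1 : ℕ) : ℤ) (by push_cast; ring))
  have a1 := hw hba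
  have a2 := hw hca
  have a3 : Gamma (((k + 1 + m + k : ℕ) : ℂ) + a) ≠ 0 :=
    NonInt.Gamma_ne_zero (ha.of_eq_add ((k + 1 + m + k : ℕ) : ℤ) (by push_cast; ring))
  have b1 := hka.Gamma_ne_zero
  have b2 := h1d.Gamma_ne_zero
  have hv : ∀ {z : ℂ}, NonInt (z - a) → Gamma (k + (1 + a - z)) ≠ 0 := fun {z} h =>
    NonInt.Gamma_ne_zero (h.of_eq_sub (k + 1) (by push_cast; ring))
  have b3 := hv hba
  have b4 := hv hca
  have s1 := hba.Sn_ne_zero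
  have s2 := hca.Sn_ne_zero
  have f1 := factorial_ne k
  have f2 := factorial_ne m
  have p0 : (Real.pi : ℂ) ≠ 0 := by simp [Real.pi_ne_zero]
  have hm : ((-1 : ℂ) ^ (k + 1 + m)) * (-1) ^ (k + 1 + m) = 1 := by rw [← mul_pow]; simp
  have hm0 : (-1 : ℂ) ^ (k + 1 + m) ≠ 0 := by simp
  have hk0 : (-1 : ℂ) ^ k ≠ 0 := by simp
  rw [pow_add _ (k + 1 + m) nd]
  clear c1 c2 c3 c4 c5 hw hv hfac hndc hngc hnd hng hk h1d hka ha hba hca hda hea hfa hga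
  generalize Gamma (((k + 1 + m + k : ℕ) : ℂ) + a) = A1 at *
  generalize Gamma (((k + 1 + m + k : ℕ) : ℂ) + (M + 1 + a - d)) = A2 at *
  generalize Gamma (((m + 1 : ℕ) : ℂ) + (b - a)) = A3 at *
  generalize Gamma (((m + 1 : ℕ) : ℂ) + (c - a)) = A4 at *
  generalize Gamma (((m + 1 : ℕ) : ℂ) + (e - a)) = A5 at *
  generalize Gamma (((m + 1 : ℕ) : ℂ) + (f - a)) = A6 at *
  generalize Gamma (((m + 1 : ℕ) : ℂ) + (g - a - 2 - M)) = A7 at *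
  generalize Gamma (k + a) = B1 at *
  generalize Gamma (k + (1 + a - b)) = B2 at *
  generalize Gamma (k + (1 + a - c)) = B3 at *
  generalize Gamma (k + (1 + a - d)) = B4 at *
  generalize Gamma (k + (1 + a - e)) = B5 at *
  generalize Gamma (k + (1 + a - f)) = B6 at *
  generalize Gamma (k + (1 + a - g)) = B7 at *
  generalize (k.factorial : ℂ) = F1 at *
  generalize (m.factorial : ℂ) = F2 at *
  generalize (-1 : ℂ) ^ nd = t1 at *
  generalize (-1 : ℂ) ^ (k + 1 + m) = t3 at *
  generalize (-1 : ℂ) ^ k = t2 at *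
  generalize Sn (b - a) = S1 at *
  generalize Sn (c - a) = S2 at *
  generalize Sn (e - a) = S3 at *
  generalize Sn (f - a) = S4 at *
  generalize Sn (g - a) = S5 at *
  generalize (Real.pi : ℂ) = p at *
  field_simp
  linear_combination -(A5 * B5 * S3 * A6 * B6 * S4 * A7 * B7 * S5 * t1 * A2) * hm

lemma tendsto_residue_sum_first {a b c d e f g : ℂ} {M : ℤ} (hs : e + f + g = a + b + c + d + 1)
    (hM : |(d - 1 - M).re| ≤ 1 / 2)
    (ha : NonInt a) (hb : NonInt b) (hc : NonInt c) (hd : NonInt d)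
    (he : NonInt e) (hf : NonInt f) (hg : NonInt g) :
    Filter.Tendsto (fun n : ℕ => ∑ k ∈ Finset.range n,
      (Gamma (k + a) * Gamma (k + b) * Gamma (k + c) * Gamma (k + d)) /
        ((k.factorial : ℂ) * Gamma (k + e) * Gamma (k + f) * Gamma (k + g)) *
        (gammaRatio (M + 1 - d) 0 (n - k) * (gammaRatio e a (n + k) * gammaRatio f b (n + k) *
          gammaRatio (g - 2 - M) c (n + k)))) Filter.atTop (nhds (Fstar a b c d e f g)) := by
  have hX := tendsto_gammaRatio (tendsto_Gamma_add_nat (z := M + 1 - d)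
    (hd.of_eq_sub (M + 1) (by push_cast; ring))) tendsto_Gamma_natCast
  have hY := ((tendsto_gammaRatio (tendsto_Gamma_add_nat he) (tendsto_Gamma_add_nat ha)).cpow_mul
    rfl (tendsto_gammaRatio (tendsto_Gamma_add_nat hf) (tendsto_Gamma_add_nat hb))).cpow_mul
    (t := -(M + 1 - d - 0)) (by linear_combination -hs)
    (tendsto_gammaRatio (tendsto_Gamma_add_nat (z := g - 2 - M)
      (hg.of_eq_add (-2 - M) (by push_cast; ring))) (tendsto_Gamma_add_nat hc))
  have hr : |(M + 1 - d - 0).re| ≤ 1 / 2 := by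
    rw [← abs_neg, ← neg_re, show -(M + 1 - d - 0) = d - 1 - M by ring]
    exact hM
  simp only [cpow_neg, div_inv_eq_mul] at hY
  have h := tendsto_weighted_sum hr (Fstar_term_asymptotics hs ha hb hc hd he hf hg) hX hY
  exact h

lemma tendsto_residue_sum {a b c d e f g : ℂ} {M : ℤ} (hs : e + f + g = a + b + c + d + 1)
    (hM : |(d - 1 - M).re| ≤ 1 / 2)
    (ha : NonInt a) (hba : NonInt (b - a)) (hca : NonInt (c - a)) (hda : NonInt (d - a))
    (hea : NonInt (e - a)) (hfa : NonInt (f - a)) (hga : NonInt (g - a)) :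
    Filter.Tendsto (fun n : ℕ => ∑ k ∈ Finset.range n,
      (Gamma (k + a) * Gamma (k + (1 + a - e)) * Gamma (k + (1 + a - f)) *
        Gamma (k + (1 + a - g))) / ((k.factorial : ℂ) * Gamma (k + (1 + a - b)) *
        Gamma (k + (1 + a - c)) * Gamma (k + (1 + a - d))) *
        (gammaRatio (e - a) (b - a) (n - k) * gammaRatio (f - a) (c - a) (n - k) *
          gammaRatio (g - a - 2 - M) 0 (n - k) * gammaRatio (M + 1 + a - d) a (n + k)))
      Filter.atTop (nhds (Fstar a (1 + a - e) (1 + a - f) (1 + a - g) (1 + a - b) (1 + a - c)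
        (1 + a - d))) := by
  have hX := ((tendsto_gammaRatio (tendsto_Gamma_add_nat hea) (tendsto_Gamma_add_nat hba)).cpow_mul
    rfl (tendsto_gammaRatio (tendsto_Gamma_add_nat hfa) (tendsto_Gamma_add_nat hca))).cpow_mul
    (t := d - 1 - M) (by linear_combination -hs)
    (tendsto_gammaRatio (tendsto_Gamma_add_nat (z := g - a - 2 - M)
      (hga.of_eq_add (-2 - M) (by push_cast; ring))) tendsto_Gamma_natCast)
  have hY := tendsto_gammaRatio (tendsto_Gamma_add_nat (z := M + 1 + a - d)
    (hda.of_eq_sub (M + 1) (by push_cast; ring))) (tendsto_Gamma_add_nat ha)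
  have hu := Fstar_term_asymptotics (x₁ := a) (x₂ := 1 + a - e) (x₃ := 1 + a - f)
    (x₄ := 1 + a - g) (e := 1 + a - b) (f := 1 + a - c) (g := 1 + a - d)
    (by linear_combination hs) ha
    (hea.of_eq_sub 1 (by push_cast; ring)) (hfa.of_eq_sub 1 (by push_cast; ring))
    (hga.of_eq_sub 1 (by push_cast; ring)) (hba.of_eq_sub 1 (by push_cast; ring))
    (hca.of_eq_sub 1 (by push_cast; ring)) (hda.of_eq_sub 1 (by push_cast; ring))
  rw [show M + 1 + a - d - a = -(d - 1 - M) by ring] at hY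
  simp only [cpow_neg, div_inv_eq_mul] at hY
  have h := tendsto_weighted_sum hM hu hX hY
  exact h

lemma sum_residues_four (x₀ x₁ x₂ x₃ y₀ y₁ y₂ y₃ : ℂ) (n N₀ N₁ N₂ N₃ : ℕ)
    (h₁₀ : NonInt (x₁ - x₀)) (h₂₀ : NonInt (x₂ - x₀)) (h₃₀ : NonInt (x₃ - x₀))
    (h₂₁ : NonInt (x₂ - x₁)) (h₃₁ : NonInt (x₃ - x₁)) (h₃₂ : NonInt (x₃ - x₂))
    (hN : N₀ + N₁ + N₂ + N₃ + 2 ≤ 4 * n) (R : ℂ → ℂ → ℂ → ℂ → ℕ → ℂ)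
    (hR : ∀ x u v w k, R x u v w k =
      poch (y₀ - x - k) N₀ * poch (y₁ - x - k) N₁ * poch (y₂ - x - k) N₂ * poch (y₃ - x - k) N₃ /
      ((-1) ^ k * k.factorial * (n - 1 - k).factorial *
        (poch (u - x - k) n * poch (v - x - k) n * poch (w - x - k) n))) :
    ∑ k ∈ Finset.range n, R x₀ x₁ x₂ x₃ k + ∑ k ∈ Finset.range n, R x₁ x₀ x₂ x₃ k +
      ∑ k ∈ Finset.range n, R x₂ x₀ x₁ x₃ k + ∑ k ∈ Finset.range n, R x₃ x₀ x₁ x₂ k = 0 := by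
  have swap : ∀ {u v : ℂ}, NonInt (u - v) → NonInt (v - u) := fun h =>
    h.of_eq_sub 0 (by push_cast; ring)
  have key := sum_residues_eq_zero ![x₀, x₁, x₂, x₃] ![y₀, y₁, y₂, y₃] n ![N₀, N₁, N₂, N₃]
    (by
      intro i j hij
      fin_cases i <;> fin_cases j <;> first | exact absurd rfl hij | assumption | (apply swap; assumption))
    (by rw [Fin.sum_univ_four]; exact hN)
  have e0 : Finset.univ.erase (0 : Fin 4) = {1, 2, 3} := by decide
  have e1 : Finset.univ.erase (1 : Fin 4) = {0, 2, 3} := by decide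
  have e2 : Finset.univ.erase (2 : Fin 4) = {0, 1, 3} := by decide
  have e3 : Finset.univ.erase (3 : Fin 4) = {0, 1, 2} := by decide
  simp only [Fin.sum_univ_four, Fin.prod_univ_four, e0, e1, e2, e3] at key
  simp only [Finset.prod_insert, Finset.prod_singleton, Finset.mem_insert, Finset.mem_singleton,
    Fin.reduceEq, or_self, not_false_eq_true, ← mul_assoc] at key
  simp only [hR, ← mul_assoc]
  exact key

/-- The relation between the residue series of four arithmetic progressions of poles. -/
lemma Fstar_four_term {a b c d e f g : ℂ} (hs : e + f + g = a + b + c + d + 1)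
    (ha : NonInt a) (hb : NonInt b) (hc : NonInt c) (hd : NonInt d)
    (he : NonInt e) (hf : NonInt f) (hg : NonInt g)
    (hba : NonInt (b - a)) (hca : NonInt (c - a)) (hcb : NonInt (c - b))
    (hda : NonInt (d - a)) (hdb : NonInt (d - b)) (hdc : NonInt (d - c))
    (hea : NonInt (e - a)) (heb : NonInt (e - b)) (hec : NonInt (e - c))
    (hfa : NonInt (f - a)) (hfb : NonInt (f - b)) (hfc : NonInt (f - c))
    (hga : NonInt (g - a)) (hgb : NonInt (g - b)) (hgc : NonInt (g - c)) :
    Sn d * Fstar a b c d e f g =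
      Sn (e - a) * Sn (f - a) * Sn (g - a) / (Sn (b - a) * Sn (c - a)) *
        Fstar a (1 + a - e) (1 + a - f) (1 + a - g) (1 + a - b) (1 + a - c) (1 + a - d) +
      Sn (e - b) * Sn (f - b) * Sn (g - b) / (Sn (a - b) * Sn (c - b)) *
        Fstar b (1 + b - e) (1 + b - f) (1 + b - g) (1 + b - a) (1 + b - c) (1 + b - d) +
      Sn (e - c) * Sn (f - c) * Sn (g - c) / (Sn (a - c) * Sn (b - c)) *
        Fstar c (1 + c - e) (1 + c - f) (1 + c - g) (1 + c - a) (1 + c - b) (1 + c - d) := by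
  have swap : ∀ {u v : ℂ}, NonInt (u - v) → NonInt (v - u) := fun h =>
    h.of_eq_sub 0 (by push_cast; ring)
  obtain ⟨M, hM⟩ : ∃ M : ℤ, |(d - 1 - M).re| ≤ 1 / 2 :=
    ⟨round (d.re - 1), by simpa using abs_sub_round (d.re - 1)⟩
  have t0 := (tendsto_residue_sum_first hs hM ha hb hc hd he hf hg).const_mul (-(Sn d / Real.pi))
  have t1 := (tendsto_residue_sum hs hM ha hba hca hda hea hfa hga).const_mul
    (Sn (e - a) * Sn (f - a) * Sn (g - a) / (Real.pi * Sn (b - a) * Sn (c - a)))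
  have t2 := (tendsto_residue_sum (a := b) (b := a) (by linear_combination hs) hM hb (swap hba)
    hcb hdb heb hfb hgb).const_mul
    (Sn (e - b) * Sn (f - b) * Sn (g - b) / (Real.pi * Sn (a - b) * Sn (c - b)))
  have t3 := (tendsto_residue_sum (a := c) (b := a) (c := b) (by linear_combination hs) hM hc
    (swap hca) (swap hcb) hdc hec hfc hgc).const_mul
    (Sn (e - c) * Sn (f - c) * Sn (g - c) / (Real.pi * Sn (a - c) * Sn (b - c)))
  have t := ((t0.add t1).add t2).add t3
  have hzero := tendsto_nhds_unique_of_eventuallyEq t (tendsto_const_nhds (x := (0 : ℂ))) (by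
    filter_upwards [Filter.eventually_ge_atTop (M.natAbs + 2)] with n hn
    obtain ⟨nd, hnd⟩ : ∃ nd : ℕ, (nd : ℤ) = n + M := ⟨(n + M).toNat, by omega⟩
    obtain ⟨ng, hng⟩ : ∃ ng : ℕ, (ng : ℤ) = n - 2 - M := ⟨(n - 2 - M).toNat, by omega⟩
    have key := sum_residues_four (1 - n) a b c e f g (d - nd) n n n ng nd
      (ha.of_eq_add (n - 1) (by push_cast; ring)) (hb.of_eq_add (n - 1) (by push_cast; ring))
      (hc.of_eq_add (n - 1) (by push_cast; ring)) hba hca hcb (by omega) _ fun _ _ _ _ _ => rfl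
    rw [← Finset.sum_range_reflect] at key
    have hsgn : (-1 : ℂ) ^ (n + nd) ≠ 0 := by simp
    refine mul_left_cancel₀ hsgn ?_
    rw [mul_zero]
    refine Eq.trans ?_ key
    rw [mul_add, mul_add, mul_add]
    congr 1
    · congr 1
      · congr 1
        · rw [← mul_assoc, Finset.mul_sum]
          refine Finset.sum_congr rfl fun k hk => ?_
          have hk' : k < n := by simpa using hk
          have h := residue_term_first hk' hnd hng ha hb hc hd he hf hg
          have hc' : ((n - 1 - k : ℕ) : ℂ) = n - 1 - k := by
            rw [Nat.sub_sub, Nat.cast_sub (by omega)]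
            push_cast
            ring
          have hz : ∀ z : ℂ, z - (1 - n) - ((n - 1 - k : ℕ) : ℂ) = z + k := fun z => by
            rw [hc']
            ring
          rw [hz, hz, hz, hz, hz, hz, hz, show n - 1 - (n - 1 - k) = k by omega, h]
          ring
        · rw [← mul_assoc, Finset.mul_sum]
          refine Finset.sum_congr rfl fun k hk => ?_
          rw [← residue_term (by simpa using hk) hnd hng ha hba hca hda hea hfa hga]
      · rw [← mul_assoc, Finset.mul_sum]
        refine Finset.sum_congr rfl fun k hk => ?_
        rw [← residue_term (by simpa using hk) hnd hng hb (swap hba) hcb hdb heb hfb hgb]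
    · rw [← mul_assoc, Finset.mul_sum]
      refine Finset.sum_congr rfl fun k hk => ?_
      rw [← residue_term (by simpa using hk) hnd hng hc (swap hca) (swap hcb) hdc hec hfc hgc])
  have s1 := hba.Sn_ne_zero
  have s2 := hca.Sn_ne_zero
  have s3 := hcb.Sn_ne_zero
  have s4 := (swap hba).Sn_ne_zero
  have s5 := (swap hca).Sn_ne_zero
  have s6 := (swap hcb).Sn_ne_zero
  have p0 : (Real.pi : ℂ) ≠ 0 := by simp [Real.pi_ne_zero]
  have hmul := congrArg (fun z => (Real.pi : ℂ) * z) hzero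
  have e1 : ∀ P S T D : ℂ, (Real.pi : ℂ) * (P / (Real.pi * S * T) * D) = P / (S * T) * D := by
    intro P S T D
    rw [← mul_assoc, mul_assoc (Real.pi : ℂ) S T, ← mul_div_assoc, mul_div_mul_left _ _ p0]
  simp only [mul_add, e1, mul_zero] at hmul
  have e2 : ∀ U : ℂ, (Real.pi : ℂ) * (-(Sn d / Real.pi) * U) = -(Sn d * U) := by
    intro U
    field_simp
  rw [e2] at hmul
  linear_combination -hmul

lemma Sn_four_term {a b c d e f g : ℂ} (hs : e + f + g = a + b + c + d + 1) :
    Sn (b - a) * (Sn (e - c) * Sn (f - c) * Sn (g - c)) -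
      Sn (b - c) * (Sn (b - a) * Sn (c - a) * Sn d + Sn (e - a) * Sn (f - a) * Sn (g - a)) =
    Sn (c - a) * (Sn (e - b) * Sn (f - b) * Sn (g - b)) := by
  have hd : Sn d = -Sn (e + f + g - a - b - c) := by
    rw [show e + f + g - a - b - c = d + 1 by linear_combination hs, Sn_add_one, neg_neg]
  have key : ∀ z : ℂ, Sn z = ((exp (Real.pi * z * I))⁻¹ - exp (Real.pi * z * I)) * I / 2 := by
    intro z
    rw [Sn, Complex.sin, ← exp_neg, neg_mul]
  rw [hd]
  simp only [key, mul_add, mul_sub, add_mul, sub_mul, exp_add, exp_sub]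
  have na := exp_ne_zero (Real.pi * a * I)
  have nb := exp_ne_zero (Real.pi * b * I)
  have nc := exp_ne_zero (Real.pi * c * I)
  have ne := exp_ne_zero (Real.pi * e * I)
  have nf := exp_ne_zero (Real.pi * f * I)
  have ng := exp_ne_zero (Real.pi * g * I)
  generalize exp (Real.pi * a * I) = A at *
  generalize exp (Real.pi * b * I) = B at *
  generalize exp (Real.pi * c * I) = C at *
  generalize exp (Real.pi * e * I) = E at *
  generalize exp (Real.pi * f * I) = F at *
  generalize exp (Real.pi * g * I) = G at *
  field_simp
  ring

lemma inv_Gamma_one_sub {z w : ℂ} (hz : NonInt z) (hw : w = 1 - z) :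
    (Gamma w)⁻¹ = Gamma z * Sn z / Real.pi := by
  have h := Gamma_mul_Sn hz
  have h1 : Gamma (1 - z) ≠ 0 := (hz.of_eq_sub 1 (by push_cast; ring)).Gamma_ne_zero
  have p0 : (Real.pi : ℂ) ≠ 0 := by simp [Real.pi_ne_zero]
  rw [hw]
  field_simp
  linear_combination -h

lemma Sn_one_add (z : ℂ) : Sn (1 + z) = -Sn z := by rw [add_comm, Sn_add_one]

lemma inv_Gamma_sub {z w : ℂ} (h : NonInt (w - z)) :
    (Gamma (w - z))⁻¹ = Gamma (1 + z - w) * Sn (w - z) / Real.pi := by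
  rw [inv_Gamma_one_sub (z := 1 + z - w) (h.of_eq_sub 1 (by push_cast; ring)) (by ring),
    show 1 + z - w = 1 + -(w - z) by ring, Sn_one_add, Sn_neg, neg_neg]

theorem orbit3_LKK_relation (a b c d e f g : ℂ)
    (hsaal : e + f + g = a + b + c + d + 1)
    (hint : ∀ i : Fin 7, ∀ n : ℤ, ![a, b, c, d, e, f, g] i ≠ (n : ℂ))
    (hdiff : ∀ i j : Fin 7, i ≠ j → ∀ n : ℤ,
      ![a, b, c, d, e, f, g] i - ![a, b, c, d, e, f, g] j ≠ (n : ℂ)) :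
    Sn c * Af (1 - a) (e - a) (f - a) (g - a) * Af b (1 + b - e) (1 + b - f) (1 + b - g) *
        Kf a b c d e f g -
      Sn (b - a) * Af a b c d * Af (1 - c) (e - c) (f - c) (g - c) *
        Lf (1 - a) (e - a) (f - a) (g - a) (1 + d - a) (1 + c - a) (1 + b - a) -
      B1 a b c d e f g * Kf b a c d e f g = 0 := by
  have ha : NonInt a := hint 0
  have hb : NonInt b := hint 1
  have hc : NonInt c := hint 2
  have hd : NonInt d := hint 3
  have he : NonInt e := hint 4
  have hf : NonInt f := hint 5
  have hg : NonInt g := hint 6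
  have hba : NonInt (b - a) := hdiff 1 0 (by decide)
  have hca : NonInt (c - a) := hdiff 2 0 (by decide)
  have hcb : NonInt (c - b) := hdiff 2 1 (by decide)
  have hbc : NonInt (b - c) := hdiff 1 2 (by decide)
  have hda : NonInt (d - a) := hdiff 3 0 (by decide)
  have hdb : NonInt (d - b) := hdiff 3 1 (by decide)
  have hdc : NonInt (d - c) := hdiff 3 2 (by decide)
  have hea : NonInt (e - a) := hdiff 4 0 (by decide)
  have heb : NonInt (e - b) := hdiff 4 1 (by decide)
  have hec : NonInt (e - c) := hdiff 4 2 (by decide)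
  have hed : NonInt (e - d) := hdiff 4 3 (by decide)
  have hfa : NonInt (f - a) := hdiff 5 0 (by decide)
  have hfb : NonInt (f - b) := hdiff 5 1 (by decide)
  have hfc : NonInt (f - c) := hdiff 5 2 (by decide)
  have hfd : NonInt (f - d) := hdiff 5 3 (by decide)
  have hga : NonInt (g - a) := hdiff 6 0 (by decide)
  have hgb : NonInt (g - b) := hdiff 6 1 (by decide)
  have hgc : NonInt (g - c) := hdiff 6 2 (by decide)
  have hgd : NonInt (g - d) := hdiff 6 3 (by decide)
  have F1 : Fstar b a c d e f g = Fstar a b c d e f g :=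
    tsum_congr fun k => by ring
  have F2 : Fstar b (1 + b - e) (1 + b - f) (1 + b - g) (1 + b - c) (1 + b - a) (1 + b - d) =
      Fstar b (1 + b - e) (1 + b - f) (1 + b - g) (1 + b - a) (1 + b - c) (1 + b - d) :=
    tsum_congr fun k => by ring
  have F3 : Fstar c (1 + c - e) (1 + c - f) (1 + c - g) (1 + c - b) (1 + c - a) (1 + c - d) =
      Fstar c (1 + c - e) (1 + c - f) (1 + c - g) (1 + c - a) (1 + c - b) (1 + c - d) :=
    tsum_congr fun k => by ring
  have swapL : ∀ x₁ x₂ x₃ x₄ p q r : ℂ, Lf x₁ x₂ x₃ x₄ p q r = Lf x₁ x₂ x₃ x₄ p r q := by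
    have h : ∀ x₁ x₂ x₃ x₄ p q r : ℂ, Fstar x₁ x₂ x₃ x₄ p q r = Fstar x₁ x₂ x₃ x₄ p r q :=
      fun _ _ _ _ _ _ _ => tsum_congr fun k => by ring
    intro x₁ x₂ x₃ x₄ p q r
    rw [Lf, Lf, h, h (1 + x₁ - p)]
  have hL := Lf_two_term (x₁ := b) (x₂ := 1 + b - e) (x₃ := 1 + b - f) (x₄ := 1 + b - g)
    (e := 1 + b - c) (f := 1 + b - a) (g := 1 + b - d) (by linear_combination hsaal) hb
    (heb.of_eq_sub 1 (by push_cast; ring)) (hfb.of_eq_sub 1 (by push_cast; ring))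
    (hgb.of_eq_sub 1 (by push_cast; ring)) (hbc.of_eq_add 1 (by push_cast; ring))
    (hba.of_eq_add 1 (by push_cast; ring)) (hdb.of_eq_sub 1 (by push_cast; ring))
    (hc.of_eq_add (-1) (by push_cast; ring)) (hec.of_eq_sub 0 (by push_cast; ring))
    (hfc.of_eq_sub 0 (by push_cast; ring)) (hgc.of_eq_sub 0 (by push_cast; ring))
    (ha.of_eq_add (-1) (by push_cast; ring)) (hea.of_eq_sub 0 (by push_cast; ring))
    (hfa.of_eq_sub 0 (by push_cast; ring)) (hga.of_eq_sub 0 (by push_cast; ring))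
    (hd.of_eq_add (-1) (by push_cast; ring)) (hed.of_eq_sub 0 (by push_cast; ring))
    (hfd.of_eq_sub 0 (by push_cast; ring)) (hgd.of_eq_sub 0 (by push_cast; ring))
    (hca.of_eq_add 0 (by push_cast; ring)) (hdc.of_eq_sub 0 (by push_cast; ring))
    (hda.of_eq_add 0 (by push_cast; ring))
  rw [show 1 + b - a - b = 1 - a by ring, show 1 + b - a - (1 + b - e) = e - a by ring,
    show 1 + b - a - (1 + b - f) = f - a by ring, show 1 + b - a - (1 + b - g) = g - a by ring,
    show 1 + (1 + b - a) - (1 + b - d) = 1 + d - a by ring,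
    show 1 + (1 + b - a) - (1 + b - c) = 1 + c - a by ring, Lf, F2,
    show 1 + b - (1 + b - c) = c by ring, show 1 + (1 + b - e) - (1 + b - c) = 1 + c - e by ring,
    show 1 + (1 + b - f) - (1 + b - c) = 1 + c - f by ring,
    show 1 + (1 + b - g) - (1 + b - c) = 1 + c - g by ring,
    show 2 - (1 + b - c) = 1 + c - b by ring,
    show 1 + (1 + b - a) - (1 + b - c) = 1 + c - a by ring,
    show 1 + (1 + b - d) - (1 + b - c) = 1 + c - d by ring, F3,
    show Sn (1 + b - c) = -Sn (b - c) by rw [add_sub_assoc, Sn_one_add]] at hL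
  have R := Fstar_four_term hsaal ha hb hc hd he hf hg hba hca hcb hda hdb hdc hea heb hec
    hfa hfb hfc hga hgb hgc
  have T := Sn_four_term hsaal
  rw [swapL, ← hL, Kf, Kf, F1, B1, Af, Af, Af, Af]
  have hC : ∀ {z w : ℂ}, NonInt (w - z) → Gamma (1 + z - w) ≠ 0 := fun h =>
    (h.of_eq_sub 1 (by push_cast; ring)).Gamma_ne_zero
  have Xa := ha.Gamma_ne_zero
  have Xb := hb.Gamma_ne_zero
  have Xc := hc.Gamma_ne_zero
  have Xd := hd.Gamma_ne_zero
  have Ya := ha.Sn_ne_zero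
  have Yb := hb.Sn_ne_zero
  have Aea := hC hea
  have Afa := hC hfa
  have Aga := hC hga
  have Aeb := hC heb
  have Afb := hC hfb
  have Agb := hC hgb
  have Aec := hC hec
  have Afc := hC hfc
  have Agc := hC hgc
  have sba := hba.Sn_ne_zero
  have sca := hca.Sn_ne_zero
  have sbc := hbc.Sn_ne_zero
  have p0 : (Real.pi : ℂ) ≠ 0 := by simp [Real.pi_ne_zero]
  simp only [one_div, mul_inv, inv_Gamma_one_sub ha rfl, inv_Gamma_one_sub hc rfl,
    inv_Gamma_sub hea, inv_Gamma_sub hfa, inv_Gamma_sub hga,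
    inv_Gamma_sub hec, inv_Gamma_sub hfc, inv_Gamma_sub hgc]
  rw [show Sn (a - b) = -Sn (b - a) by rw [← Sn_neg, neg_sub],
    show Sn (a - c) = -Sn (c - a) by rw [← Sn_neg, neg_sub],
    show Sn (c - b) = -Sn (b - c) by rw [← Sn_neg, neg_sub]] at R
  clear hL hC swapL F1 F2 F3 hint hdiff hsaal ha hb hc hd he hf hg hba hca hcb hbc hda hdb hdc hea heb
    hec hed hfa hfb hfc hfd hga hgb hgc hgd
  generalize Fstar a b c d e f g = U at *
  generalize Fstar a (1 + a - e) (1 + a - f) (1 + a - g) (1 + a - b) (1 + a - c) (1 + a - d) = Da at *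
  generalize Fstar b (1 + b - e) (1 + b - f) (1 + b - g) (1 + b - a) (1 + b - c) (1 + b - d) = Db at *
  generalize Fstar c (1 + c - e) (1 + c - f) (1 + c - g) (1 + c - a) (1 + c - b) (1 + c - d) = Dc at *
  generalize Gamma a = Γa at *
  generalize Gamma b = Γb at *
  generalize Gamma c = Γc at *
  generalize Gamma d = Γd at *
  generalize Gamma (1 + a - e) = Γea at *
  generalize Sn (e - a) = Sea at *
  generalize Gamma (1 + a - f) = Γfa at *
  generalize Sn (f - a) = Sfa at *
  generalize Gamma (1 + a - g) = Γga at *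
  generalize Sn (g - a) = Sga at *
  generalize Gamma (1 + b - e) = Γeb at *
  generalize Sn (e - b) = Seb at *
  generalize Gamma (1 + b - f) = Γfb at *
  generalize Sn (f - b) = Sfb at *
  generalize Gamma (1 + b - g) = Γgb at *
  generalize Sn (g - b) = Sgb at *
  generalize Gamma (1 + c - e) = Γec at *
  generalize Sn (e - c) = Sec at *
  generalize Gamma (1 + c - f) = Γfc at *
  generalize Sn (f - c) = Sfc at *
  generalize Gamma (1 + c - g) = Γgc at *
  generalize Sn (g - c) = Sgc at *
  generalize Sn a = Sa at *
  generalize Sn b = Sb at *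
  generalize Sn c = Sc at *
  generalize Sn d = Sd at *
  generalize Sn (b - a) = Sba at *
  generalize Sn (c - a) = Sca at *
  generalize Sn (b - c) = Sbc at *
  field_simp at R ⊢
  linear_combination Sc * Db * T - Sc * R
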